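/- The unique stationary measure m_{τ,ε} of the noisy Arnol'd circle map family is absolutely continuous with respect to Lebesgue (Haar) measure on ℝ/ℤ, with a density φ_{τ,ε} that is C^∞ on ℝ/ℤ; moreover, for fixed ε and σ, the density depends C^∞-smoothly on the parameter τ, i.e. (τ, x) ↦ φ_{τ,ε}(x) is C^∞ in τ. -/

import Mathlib

open MeasureTheory Real Filter Set Function

noncomputable section

lemma sin2_periodic : Function.Periodic (fun x : ℝ => Real.sin (2 * π * x)) 1 := by
  intro x
  simp only [mul_add, mul_one]
  exact Real.sin_add_two_pi _

/-- `sin (2πx)` viewed as a function on the circle `ℝ/ℤ`. -/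
def sinA : AddCircle (1:ℝ) → ℝ := sin2_periodic.lift

/-- The noisy Arnol'd circle map `F_w(x) = x + τ + σ w − ε sin (2πx)  (mod 1)`. -/
def Fmap (τ ε σ w : ℝ) : AddCircle (1:ℝ) → AddCircle (1:ℝ) :=
  fun x => x + (↑(τ + σ * w - ε * sinA x) : AddCircle (1:ℝ))

/-- The uniform probability measure on `I = [−1/2, 1/2]`. -/
def nuI : Measure ℝ := volume.restrict (Icc (-(1/2) : ℝ) (1/2))

/-- A Borel probability measure `m` on the circle is stationary for the noisy circle-map
family when `∫_I (F_w)_* m dν(w) = m`. -/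
def IsStationaryMeasure (τ ε σ : ℝ) (m : Measure (AddCircle (1:ℝ))) : Prop :=
  nuI.bind (fun w => m.map (Fmap τ ε σ w)) = m

/-- The entire extension of the lift `x ↦ x + τ − ε sin (2πx)` of the Arnol'd map. -/
def arnoldC (τ ε : ℝ) (z : ℂ) : ℂ := z + τ - ε * Complex.sin (2 * π * z)

/-- The derivative of `arnoldC`. -/
def arnoldC' (ε : ℝ) (z : ℂ) : ℂ := 1 - ε * (2 * π * Complex.cos (2 * π * z))

lemma arnoldC_hasStrictDerivAt (τ ε : ℝ) (z : ℂ) :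
    HasStrictDerivAt (arnoldC τ ε) (arnoldC' ε z) z := by
  have h1 : HasStrictDerivAt (fun z : ℂ => 2 * π * z) (2 * π) z := by
    simpa using (hasStrictDerivAt_id z).const_mul (2 * π : ℂ)
  have h2 := ((Complex.hasStrictDerivAt_sin (2 * π * z)).comp z h1).const_mul (ε : ℂ)
  have h3 := ((hasStrictDerivAt_id z).add_const (τ : ℂ)).sub h2
  have h4 : arnoldC' ε z = 1 - ε * (Complex.cos (2 * π * z) * (2 * π)) := by
    rw [arnoldC']; ring
  rw [h4]
  exact h3

lemma arnoldC_hasDerivAt (τ ε : ℝ) (z : ℂ) :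
    HasDerivAt (arnoldC τ ε) (arnoldC' ε z) z := (arnoldC_hasStrictDerivAt τ ε z).hasDerivAt

lemma arnoldC_differentiable (τ ε : ℝ) : Differentiable ℂ (arnoldC τ ε) :=
  fun z => (arnoldC_hasDerivAt τ ε z).differentiableAt

lemma arnoldC_continuous (τ ε : ℝ) : Continuous (arnoldC τ ε) :=
  (arnoldC_differentiable τ ε).continuous

lemma sq_sinh_le_normSq_sin (z : ℂ) : Real.sinh z.im ^ 2 ≤ Complex.normSq (Complex.sin z) := by
  rw [Complex.sin_eq, Complex.normSq_apply]
  have h1 : (Complex.sin ↑z.re * Complex.cosh ↑z.im + Complex.cos ↑z.re * Complex.sinh ↑z.im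
      * Complex.I) = ((Real.sin z.re * Real.cosh z.im : ℝ) : ℂ)
        + ((Real.cos z.re * Real.sinh z.im : ℝ) : ℂ) * Complex.I := by push_cast; ring
  rw [h1, Complex.add_re, Complex.add_im, Complex.re_ofReal_mul, Complex.im_ofReal_mul,
    Complex.ofReal_re, Complex.ofReal_im, Complex.I_re, Complex.I_im]
  nlinarith [Real.sin_sq_add_cos_sq z.re, Real.cosh_sq z.im, sq_nonneg (Real.sin z.re),
    sq_nonneg (Real.sinh z.im), mul_self_nonneg (Real.sin z.re)]

lemma sq_div_two_le_sinh {t : ℝ} (ht : 0 ≤ t) : t ^ 2 / 2 ≤ Real.sinh t := by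
  have h1 : t / 2 ≤ Real.sinh (t / 2) := Real.self_le_sinh_iff.2 (by positivity)
  have h2 : Real.sinh (t / 2) ≤ Real.cosh (t / 2) := (Real.sinh_lt_cosh _).le
  have h3 : Real.sinh t = 2 * Real.sinh (t / 2) * Real.cosh (t / 2) := by
    rw [← Real.sinh_two_mul]; ring_nf
  rw [h3]
  nlinarith

lemma sq_div_two_le_norm_sin (z : ℂ) : z.im ^ 2 / 2 ≤ ‖Complex.sin z‖ := by
  have h1 := sq_div_two_le_sinh (abs_nonneg z.im)
  rw [sq_abs] at h1
  refine h1.trans ((le_abs_self _).trans (abs_le_of_sq_le_sq ?_ (norm_nonneg _)))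
  rw [← Complex.normSq_eq_norm_sq, ← Real.abs_sinh, sq_abs]
  exact sq_sinh_le_normSq_sin z

lemma arnoldC_abs_im_le {τ ε : ℝ} (hε : 0 < ε) {M N : ℝ} {z : ℂ} (h1 : |z.re| ≤ N)
    (h2 : ‖arnoldC τ ε z‖ ≤ M) : |z.im| ≤ 1 + (M + N + |τ| + 1) / ε := by
  by_contra! hcon
  have hM : 0 ≤ M := (norm_nonneg _).trans h2
  have hN : 0 ≤ N := (abs_nonneg _).trans h1
  set C := M + N + |τ| with hC
  have hC0 : 0 ≤ C := by positivity
  have h3 := sq_div_two_le_norm_sin (2 * π * z)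
  have h4 : (2 * π * z : ℂ).im = 2 * π * z.im := by
    rw [show (2 * π * z : ℂ) = ((2 * π : ℝ) : ℂ) * z by push_cast; ring, Complex.im_ofReal_mul]
  rw [h4] at h3
  have h5 : (ε : ℂ) * Complex.sin (2 * π * z) = z + τ - arnoldC τ ε z := by
    simp only [arnoldC]; ring
  have h6 : ε * ‖Complex.sin (2 * π * z)‖ ≤ |z.re| + |z.im| + |τ| + M := by
    calc ε * ‖Complex.sin (2 * π * z)‖ = ‖(ε : ℂ) * Complex.sin (2 * π * z)‖ := by
          rw [norm_mul, Complex.norm_real, Real.norm_of_nonneg hε.le]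
      _ = ‖z + τ - arnoldC τ ε z‖ := by rw [h5]
      _ ≤ ‖z‖ + ‖(τ : ℂ)‖ + ‖arnoldC τ ε z‖ :=
          (norm_sub_le _ _).trans (by gcongr; exact norm_add_le _ _)
      _ ≤ |z.re| + |z.im| + |τ| + M := by
          gcongr
          · exact Complex.norm_le_abs_re_add_abs_im z
          · rw [Complex.norm_real]; rfl
  set Y := |z.im|
  have h7 : Y ^ 2 = z.im ^ 2 := sq_abs _
  have hd : 0 ≤ (C + 1) / ε := by positivity
  have h8 : (C + 1) / ε * ε = C + 1 := by field_simp
  have h9 : ε * Y ^ 2 ≤ ε * ‖Complex.sin (2 * π * z)‖ := by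
    gcongr
    refine le_trans ?_ h3
    rw [h7]
    nlinarith [Real.pi_gt_three, sq_nonneg z.im, mul_nonneg (sq_nonneg z.im) (sq_nonneg (π - 3)),
      mul_nonneg (sq_nonneg z.im) (sub_nonneg.2 Real.pi_gt_three.le)]
  have h10 : C + 1 < ε * Y := by nlinarith
  nlinarith

lemma arnoldC_re_of_re_int (τ ε : ℝ) {n : ℤ} {z : ℂ} (h : z.re = n) :
    (arnoldC τ ε z).re = n + τ := by
  have h1 : (2 * π * z : ℂ) = ((2 * π * z.im : ℝ) : ℂ) * Complex.I + (n : ℤ) * (2 * π) := by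
    conv_lhs => rw [← Complex.re_add_im z, h]
    push_cast; ring
  simp only [arnoldC]
  rw [h1, Complex.sin_add_int_mul_two_pi, Complex.sin_mul_I, ← Complex.ofReal_sinh,
    ← mul_assoc, ← Complex.ofReal_mul, Complex.sub_re, Complex.re_ofReal_mul, Complex.add_re, h]
  simp

lemma arnoldC_isCompact {τ ε : ℝ} (hε : 0 < ε) (M N : ℝ) :
    IsCompact {z : ℂ | |z.re| ≤ N ∧ ‖arnoldC τ ε z‖ ≤ M} := by
  refine Metric.isCompact_of_isClosed_isBounded ?_ ?_
  · exact (isClosed_le (Complex.continuous_re.abs) continuous_const).inter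
      (isClosed_le (arnoldC_continuous τ ε).norm continuous_const)
  · refine (Metric.isBounded_closedBall (x := (0 : ℂ))
      (r := N + (1 + (M + N + |τ| + 1) / ε))).subset ?_
    rintro z ⟨h1, h2⟩
    rw [mem_closedBall_zero_iff]
    exact (Complex.norm_le_abs_re_add_abs_im z).trans (add_le_add h1 (arnoldC_abs_im_le hε h1 h2))

/-- A bounded holomorphic function on a disc that avoids the critical values of `arnoldC` lifts
through `arnoldC`. -/
lemma arnoldC_exists_lift {τ ε : ℝ} (hε : 0 < ε) {H : ℂ → ℂ} {q x₀ : ℂ} {ρ M : ℝ} (hρ : 0 < ρ)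
    (hH : DifferentiableOn ℂ H (Metric.ball q ρ)) (hM : ∀ z ∈ Metric.ball q ρ, ‖H z‖ < M)
    (hcv : ∀ z ∈ Metric.ball q ρ, ∀ c, arnoldC τ ε c = H z → arnoldC' ε c ≠ 0)
    (hx₀ : arnoldC τ ε x₀ = H q) :
    ∃ G : ℂ → ℂ, DifferentiableOn ℂ G (Metric.ball q ρ) ∧
      (∀ z ∈ Metric.ball q ρ, arnoldC τ ε (G z) = H z) ∧ G q = x₀ := by
  obtain ⟨N, hN⟩ := exists_nat_gt (max (M + |τ|) |x₀.re|)
  rw [max_lt_iff] at hN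
  set E : Set ℂ := {z : ℂ | |z.re| ≤ N ∧ ‖arnoldC τ ε z‖ ≤ M} with hE
  have : CompactSpace E := isCompact_iff_compactSpace.1 (arnoldC_isCompact hε M N)
  let p : E → ℂ := fun z => arnoldC τ ε z
  let s : Set ℂ := {w | ‖w‖ < M ∧ ∀ c, arnoldC τ ε c = w → arnoldC' ε c ≠ 0}
  have hpc : Continuous p := (arnoldC_continuous τ ε).comp continuous_subtype_val
  have hcov : IsCoveringMapOn p s := by
    refine IsCoveringMapOn.of_isLocalHomeomorphOn hpc ?_
    rw [isLocalHomeomorphOn_iff_isOpenEmbedding_restrict]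
    rintro ⟨e, he⟩ ⟨he1, he2⟩
    have hne : arnoldC' ε e ≠ 0 := he2 e rfl
    have hst := (arnoldC_hasStrictDerivAt τ ε e)
    let φ := (hst.hasStrictFDerivAt_equiv hne).toOpenPartialHomeomorph (arnoldC τ ε)
    have hφs : e ∈ φ.source := (hst.hasStrictFDerivAt_equiv hne).mem_toOpenPartialHomeomorph_source
    have hφc : (φ : ℂ → ℂ) = arnoldC τ ε :=
      (hst.hasStrictFDerivAt_equiv hne).toOpenPartialHomeomorph_coe
    have hre : |e.re| < N := by
      refine lt_of_le_of_ne he.1 fun heq => ?_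
      have h1 : ∃ n : ℤ, e.re = n ∧ |(n : ℝ)| = N := by
        rcases abs_choice e.re with h | h
        · exact ⟨N, by push_cast; linarith [heq, h], by simp⟩
        · exact ⟨-N, by push_cast; linarith [heq, h], by simp⟩
      obtain ⟨n, hn, hnN⟩ := h1
      have h2 := arnoldC_re_of_re_int τ ε hn
      have h3 : |(n : ℝ) + τ| ≤ M := by
        rw [← h2]; exact (Complex.abs_re_le_norm _).trans he1.le
      have h4 : |(n : ℝ)| ≤ |(n : ℝ) + τ| + |τ| := by
        calc |(n : ℝ)| = |(n + τ) - τ| := by ring_nf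
          _ ≤ _ := abs_sub _ _
      linarith [hN.1]
    let W : Set ℂ := {z | |z.re| < N} ∩ {z | ‖arnoldC τ ε z‖ < M}
    have hW : IsOpen W := (isOpen_lt (Complex.continuous_re.abs) continuous_const).inter
      (isOpen_lt (arnoldC_continuous τ ε).norm continuous_const)
    have hWE : W ⊆ E := fun z hz => ⟨hz.1.le, hz.2.le⟩
    let U : Set E := Subtype.val ⁻¹' (φ.source ∩ W)
    have hUo : IsOpen U := (φ.open_source.inter hW).preimage continuous_subtype_val
    refine ⟨U, hUo.mem_nhds ⟨hφs, hre, he1⟩, ?_⟩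
    refine Topology.IsOpenEmbedding.of_continuous_injective_isOpenMap
      (hpc.comp continuous_subtype_val) ?_ ?_
    · rintro ⟨⟨a, ha⟩, haU⟩ ⟨⟨b, hb⟩, hbU⟩ hab
      have : a = b := φ.injOn haU.1 hbU.1 (by rw [hφc]; exact hab)
      subst this; rfl
    · intro O hO
      rw [isOpen_induced_iff] at hO
      obtain ⟨O₁, hO₁, rfl⟩ := hO
      rw [isOpen_induced_iff] at hO₁
      obtain ⟨O₂, hO₂, rfl⟩ := hO₁
      have h1 : U.domRestrict p '' (Subtype.val ⁻¹' (Subtype.val ⁻¹' O₂))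
          = φ '' (φ.source ∩ (W ∩ O₂)) := by
        rw [hφc]
        ext w; constructor
        · rintro ⟨⟨⟨a, ha⟩, haU⟩, haO, rfl⟩
          exact ⟨a, ⟨haU.1, haU.2, haO⟩, rfl⟩
        · rintro ⟨a, ⟨h1, h2, h3⟩, rfl⟩
          exact ⟨⟨⟨a, hWE h2⟩, ⟨h1, h2⟩⟩, h3, rfl⟩
      rw [h1]
      exact φ.isOpen_image_source_inter (hW.inter hO₂)
  have : ContractibleSpace (Metric.ball q ρ) :=
    (convex_ball q ρ).contractibleSpace ⟨q, Metric.mem_ball_self hρ⟩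
  have : LocallyPathConnectedSpace (Metric.ball q ρ) :=
    Metric.isOpen_ball.locallyPathConnectedSpace
  have hx₀E : x₀ ∈ E := ⟨hN.2.le, by rw [hx₀]; exact (hM q (Metric.mem_ball_self hρ)).le⟩
  obtain ⟨F, ⟨hF0, hF⟩, -⟩ := hcov.existsUnique_continuousMap_lifts
    (A := Metric.ball q ρ) ⟨fun z => H z, hH.continuousOn.domRestrict⟩
    (a₀ := ⟨q, Metric.mem_ball_self hρ⟩) (e₀ := ⟨x₀, hx₀E⟩) hx₀
    (fun a => ⟨hM a a.2, hcv a a.2⟩)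
  classical
  let G : ℂ → ℂ := fun z => if hz : z ∈ Metric.ball q ρ then (F ⟨z, hz⟩ : ℂ) else 0
  have hGF : ∀ z (hz : z ∈ Metric.ball q ρ), G z = F ⟨z, hz⟩ := fun z hz => dif_pos hz
  have hG : ∀ z ∈ Metric.ball q ρ, arnoldC τ ε (G z) = H z := fun z hz => by
    rw [hGF z hz]; exact congrFun hF ⟨z, hz⟩
  have hGc : ContinuousOn G (Metric.ball q ρ) := by
    rw [continuousOn_iff_continuous_domRestrict]
    convert (continuous_subtype_val.comp F.continuous) using 1
    ext z; exact hGF z z.2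
  refine ⟨G, fun z hz => ?_, hG, ?_⟩
  · have hne : arnoldC' ε (G z) ≠ 0 := hcv z hz _ (hG z hz)
    have hst := arnoldC_hasStrictDerivAt τ ε (G z)
    have hloc := (hst.to_localInverse hne).hasDerivAt
    rw [hG z hz] at hloc
    have hGz : ContinuousAt G z := hGc.continuousAt (Metric.isOpen_ball.mem_nhds hz)
    have h1 := hGz.eventually (hst.hasStrictFDerivAt_equiv hne).eventually_left_inverse
    have hHz := (hH.differentiableAt (Metric.isOpen_ball.mem_nhds hz)).hasDerivAt
    have h2 := hloc.comp z hHz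
    refine (h2.congr_of_eventuallyEq ?_).differentiableAt.differentiableWithinAt
    filter_upwards [h1, Metric.isOpen_ball.mem_nhds hz] with w hw hwb
    rw [Function.comp_apply, ← hG w hwb]
    exact hw.symm
  · rw [hGF q (Metric.mem_ball_self hρ), hF0]

lemma arnoldC_add_int (τ ε : ℝ) (z : ℂ) (k : ℤ) :
    arnoldC τ ε (z + k) = arnoldC τ ε z + k := by
  simp only [arnoldC]
  rw [show (2 * π * (z + k) : ℂ) = 2 * π * z + k * (2 * π) by ring, Complex.sin_add_int_mul_two_pi]
  ring

lemma arnoldC_iterate_add_int (τ ε : ℝ) (z : ℂ) (k : ℤ) (n : ℕ) :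
    (arnoldC τ ε)^[n] (z + k) = (arnoldC τ ε)^[n] z + k := by
  induction n generalizing z with
  | zero => rfl
  | succ n ih => rw [iterate_succ_apply, iterate_succ_apply, arnoldC_add_int, ih]

lemma arnoldC_conj (τ ε : ℝ) (z : ℂ) :
    arnoldC τ ε (starRingEnd ℂ z) = starRingEnd ℂ (arnoldC τ ε z) := by
  simp only [arnoldC, map_sub, map_add, map_mul, Complex.conj_ofReal, ← Complex.sin_conj, map_ofNat]

lemma arnoldC_iterate_conj (τ ε : ℝ) (z : ℂ) (n : ℕ) :
    (arnoldC τ ε)^[n] (starRingEnd ℂ z) = starRingEnd ℂ ((arnoldC τ ε)^[n] z) := by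
  induction n generalizing z with
  | zero => rfl
  | succ n ih => rw [iterate_succ_apply, iterate_succ_apply, arnoldC_conj, ih]

/-- Modulo integers and complex conjugation, `arnoldC` has a single critical point. -/
lemma arnoldC_critical_points {ε : ℝ} (hε : 0 < ε) (hεπ : 2 * π * ε < 1) {c₀ c : ℂ}
    (h₀ : arnoldC' ε c₀ = 0) (h : arnoldC' ε c = 0) :
    ∃ k : ℤ, c₀ = c + k ∨ c₀ = starRingEnd ℂ c + k := by
  have hπ : (2 * π : ℂ) ≠ 0 := by
    norm_cast; positivity
  have hεC : (ε : ℂ) ≠ 0 := by exact_mod_cast hε.ne'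
  have key : ∀ c c' : ℂ, arnoldC' ε c = 0 → arnoldC' ε c' = 0 →
      ∃ k : ℤ, c' = c + k ∨ c' = -c + k := by
    intro c c' h h'
    have hcos : Complex.cos (2 * π * c) = Complex.cos (2 * π * c') := by
      simp only [arnoldC'] at h h'
      have h3 : (ε : ℂ) * (2 * π) * (Complex.cos (2 * π * c) - Complex.cos (2 * π * c')) = 0 := by
        linear_combination h' - h
      exact sub_eq_zero.1 ((mul_eq_zero.1 h3).resolve_left (mul_ne_zero hεC hπ))
    obtain ⟨k, hk | hk⟩ := Complex.cos_eq_cos_iff.1 hcos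
    · exact ⟨k, Or.inl (mul_left_cancel₀ hπ (by rw [hk]; ring))⟩
    · exact ⟨k, Or.inr (mul_left_cancel₀ hπ (by rw [hk]; ring))⟩
  have hconj : arnoldC' ε (starRingEnd ℂ c) = 0 := by
    have : arnoldC' ε (starRingEnd ℂ c) = starRingEnd ℂ (arnoldC' ε c) := by
      simp only [arnoldC', map_sub, map_mul, Complex.conj_ofReal, map_ofNat, map_one,
        ← Complex.cos_conj]
    rw [this, h, map_zero]
  obtain ⟨k, hk | hk⟩ := key c c₀ h h₀
  · exact ⟨k, Or.inl hk⟩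
  · obtain ⟨l, hl | hl⟩ := key c _ h hconj
    · exfalso
      have him := congrArg Complex.im hl
      simp only [Complex.conj_im, Complex.add_im, Complex.intCast_im, add_zero] at him
      have hc : c = (c.re : ℂ) := by
        apply Complex.ext <;> simp; linarith
      simp only [arnoldC'] at h
      rw [hc] at h
      have h4 : ((1 - ε * (2 * π * Real.cos (2 * π * c.re)) : ℝ) : ℂ) = 0 := by
        push_cast; exact h
      rw [Complex.ofReal_eq_zero] at h4
      have h5 := Real.cos_le_one (2 * π * c.re)
      have h6 : 0 < 2 * π * ε := by positivity
      nlinarith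
    · refine ⟨k - l, Or.inr ?_⟩
      rw [hk, hl]; push_cast; ring

/-- A holomorphic function on a disc lifts through the iterates of `arnoldC` when the critical
orbits stay away from its range. -/
lemma arnoldC_iterate_exists_lift {τ ε : ℝ} (hε : 0 < ε) {N : Set ℂ}
    (hcrit : ∀ c, arnoldC' ε c = 0 → ∀ M, (arnoldC τ ε)^[M] c ∉ N) {H : ℂ → ℂ} {q : ℂ} {ρ₀ : ℝ}
    (hH : DifferentiableOn ℂ H (Metric.ball q ρ₀)) (hHN : ∀ z ∈ Metric.ball q ρ₀, H z ∈ N) (n : ℕ) :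
    ∀ {x₀ : ℂ} {ρ : ℝ}, 0 < ρ → ρ < ρ₀ → (arnoldC τ ε)^[n] x₀ = H q →
    ∃ G : ℂ → ℂ, DifferentiableOn ℂ G (Metric.ball q ρ) ∧
      (∀ z ∈ Metric.ball q ρ, (arnoldC τ ε)^[n] (G z) = H z) ∧ G q = x₀ := by
  induction n with
  | zero =>
    intro x₀ ρ h1 h2 h3
    exact ⟨H, hH.mono (Metric.ball_subset_ball h2.le), fun _ _ => rfl, h3.symm⟩
  | succ n ih =>
    intro x₀ ρ h1 h2 h3
    rw [iterate_succ_apply] at h3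
    obtain ⟨ρ', h4, h5⟩ := exists_between h2
    obtain ⟨G, hG, hGH, hGq⟩ := ih (h1.trans h4) h5 h3
    have hsub : Metric.closedBall q ρ ⊆ Metric.ball q ρ' := Metric.closedBall_subset_ball h4
    obtain ⟨M, hM⟩ := (isCompact_closedBall q ρ).exists_bound_of_continuousOn
      (hG.continuousOn.mono hsub)
    have hb : Metric.ball q ρ ⊆ Metric.ball q ρ' := Metric.ball_subset_ball h4.le
    obtain ⟨G', hG', hG'G, hG'q⟩ := arnoldC_exists_lift (τ := τ) hε (M := M + 1) h1 (hG.mono hb)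
      (fun z hz => (hM z (Metric.ball_subset_closedBall hz)).trans_lt (lt_add_one M))
      (fun z hz c hc hc0 => hcrit c hc0 (n + 1) (by
        rw [iterate_succ_apply, hc, hGH z (hb hz)]
        exact hHN z (Metric.ball_subset_ball h2.le hz))) hGq.symm
    refine ⟨G', hG', fun z hz => ?_, hG'q⟩
    rw [iterate_succ_apply, hG'G z hz, hGH z (hb hz)]

lemma arnoldC_iterate_mul (τ ε : ℝ) (n a : ℕ) (k : ℤ) (z : ℂ) :
    (arnoldC τ ε)^[n * a] z = (fun w => (arnoldC τ ε)^[n] w - k)^[a] z + (a * k : ℤ) := by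
  induction a generalizing z with
  | zero => simp
  | succ a ih =>
    have h := arnoldC_iterate_add_int τ ε ((arnoldC τ ε)^[n] z - k) k (n * a)
    rw [sub_add_cancel, ih ((arnoldC τ ε)^[n] z - k)] at h
    rw [Nat.mul_succ, iterate_add_apply, iterate_succ_apply, h, add_assoc]
    push_cast; congr 1; ring

/-- An attracting cycle must attract a critical point as soon as there is some other trap. -/
lemma arnoldC_critical_mem_basin {τ ε : ℝ} (hε : 0 < ε) {N₁ N₂ : Set ℂ} {Q P : ℂ} {r r' : ℝ}
    (hr : 0 < r) (hr' : 0 < r') (hQ : Metric.ball Q r ⊆ N₁) (hP : Metric.ball P r' ⊆ N₂)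
    (hdisj : Disjoint N₁ N₂) (hN₂ : ∀ z ∈ N₂, arnoldC τ ε z ∈ N₂)
    (hN₂' : ∀ z ∈ N₂, ∀ k : ℤ, z + k ∈ N₂) {n : ℕ} {k : ℤ}
    (hfix : (arnoldC τ ε)^[n] Q = Q + k) {l : ℂ} (hl : ‖l‖ < 1)
    (hder : HasDerivAt (arnoldC τ ε)^[n] l Q) :
    ∃ c, arnoldC' ε c = 0 ∧ ∃ M, (arnoldC τ ε)^[M] c ∈ N₁ := by
  by_contra! hcrit
  set φ : ℂ → ℂ := fun w => (arnoldC τ ε)^[n] w - k with hφ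
  have hφQ : φ Q = Q := by simp [hφ, hfix]
  have hφd : HasDerivAt φ l Q := hder.sub_const _
  have hN₂it : ∀ m, ∀ z ∈ N₂, (arnoldC τ ε)^[m] z ∈ N₂ := by
    intro m
    induction m with
    | zero => exact fun z hz => hz
    | succ m ih => exact fun z hz => ih _ (hN₂ z hz)
  set C : ℝ := (1 / r') / (r / 4) * ‖Q - P‖ ^ 2
  have hQP : Q - P ≠ 0 := by
    rw [sub_ne_zero]; rintro rfl
    exact disjoint_left.1 hdisj (hQ (Metric.mem_ball_self hr)) (hP (Metric.mem_ball_self hr'))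
  have key : ∀ a : ℕ, 1 ≤ ‖l‖ ^ a * C := by
    intro a
    have hx₀ : (arnoldC τ ε)^[n * a] (Q + (-(a * k) : ℤ)) = Q := by
      rw [arnoldC_iterate_add_int, arnoldC_iterate_mul τ ε n a k, iterate_fixed hφQ]
      push_cast; ring
    obtain ⟨G, hG, hGid, hGQ⟩ := arnoldC_iterate_exists_lift hε hcrit (H := id)
      differentiableOn_id hQ (n * a) (half_pos hr) (half_lt_self hr) hx₀
    set K : ℂ → ℂ := fun z => G z + (a * k : ℤ) with hK
    have hKQ : K Q = Q := by
      simp only [hK, hGQ]; push_cast; ring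
    have hKφ : ∀ z ∈ Metric.ball Q (r / 2), φ^[a] (K z) = z := by
      intro z hz
      have h1 := arnoldC_iterate_mul τ ε n a k (K z)
      rw [arnoldC_iterate_add_int, hGid z hz] at h1
      exact (add_right_cancel h1).symm
    have hKd : DifferentiableOn ℂ K (Metric.ball Q (r / 2)) := hG.add_const _
    have hmem : Metric.ball Q (r / 2) ∈ nhds Q := Metric.ball_mem_nhds _ (half_pos hr)
    have hKQd := (hKd.differentiableAt hmem).hasDerivAt
    have hprod : l ^ a * deriv K Q = 1 := by
      have h1 : HasDerivAt φ^[a] (l ^ a) (K Q) := by rw [hKQ]; exact HasDerivAt.iterate _ hφd hφQ a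
      refine (h1.comp Q hKQd).unique ((hasDerivAt_id Q).congr_of_eventuallyEq ?_)
      filter_upwards [hmem] with z hz using hKφ z hz
    have hfar : ∀ z ∈ Metric.ball Q (r / 2), r' ≤ ‖K z - P‖ := by
      intro z hz
      by_contra! hlt
      have h1 : K z ∈ N₂ := hP (mem_ball_iff_norm.2 hlt)
      have h2 : G z ∈ N₂ := by
        have := hN₂' _ h1 (-(a * k) : ℤ)
        convert this using 1
        simp only [hK]; push_cast; ring
      have h3 := hN₂it (n * a) _ h2
      rw [hGid z hz] at h3
      exact disjoint_left.1 hdisj (hQ (Metric.ball_subset_ball (by linarith) hz)) h3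
    have hinv : DifferentiableOn ℂ (fun z => (K z - P)⁻¹) (Metric.ball Q (r / 2)) :=
      (hKd.sub_const P).inv fun z hz h0 => by
        have := hfar z hz
        rw [h0, norm_zero] at this; linarith
    have hcb : Metric.closedBall Q (r / 4) ⊆ Metric.ball Q (r / 2) :=
      Metric.closedBall_subset_ball (by linarith)
    have hc := Complex.norm_deriv_le_of_forall_mem_sphere_norm_le (C := 1 / r')
      (by positivity : 0 < r / 4) (hinv.diffContOnCl_ball hcb) (fun z hz => by
        rw [norm_inv, one_div]
        exact inv_anti₀ hr' (hfar z (hcb (Metric.sphere_subset_closedBall hz))))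
    have hd : deriv (fun z => (K z - P)⁻¹) Q = -deriv K Q / (Q - P) ^ 2 := by
      have := (hKQd.sub_const P).fun_inv (by rwa [hKQ])
      rw [hKQ] at this
      exact this.deriv
    rw [hd, norm_div, norm_neg, norm_pow, div_le_iff₀ (by positivity)] at hc
    calc (1 : ℝ) = ‖l ^ a * deriv K Q‖ := by rw [hprod, norm_one]
      _ = ‖l‖ ^ a * ‖deriv K Q‖ := by rw [norm_mul, norm_pow]
      _ ≤ _ := by gcongr
  have hlim : Tendsto (fun a : ℕ => ‖l‖ ^ a * C) atTop (nhds (0 * C)) :=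
    (tendsto_pow_atTop_nhds_zero_of_lt_one (norm_nonneg _) hl).mul_const C
  rw [zero_mul] at hlim
  exact absurd (ge_of_tendsto' hlim key) (by norm_num)

/-- Attracting real cycles have complex trapping neighbourhoods. -/
lemma arnoldC_exists_trap {τ ε : ℝ} {U : Set ℝ} (hU : IsOpen U)
    (hUk : ∀ x ∈ U, ∀ k : ℤ, x + k ∈ U) {n : ℕ} (hn : 0 < n) {k : ℤ} {Q : ℝ}
    (hfix : (arnoldC τ ε)^[n] Q = Q + k) {l : ℂ} (hl : ‖l‖ < 1)
    (hder : HasDerivAt (arnoldC τ ε)^[n] l Q)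
    (hQU : ∀ i, ((arnoldC τ ε)^[i] Q).re ∈ U) :
    ∃ N : Set ℂ, ∃ r > 0, Metric.ball (Q : ℂ) r ⊆ N ∧ (∀ z ∈ N, arnoldC τ ε z ∈ N) ∧
      (∀ z ∈ N, starRingEnd ℂ z ∈ N) ∧ (∀ z ∈ N, ∀ j : ℤ, z + j ∈ N) ∧ ∀ z ∈ N, z.re ∈ U := by
  set φ : ℂ → ℂ := fun w => (arnoldC τ ε)^[n] w - k with hφ
  have hφQ : φ Q = Q := by simp [hφ, hfix]
  have hφd : HasDerivAt φ l Q := hder.sub_const _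
  obtain ⟨κ, hκ1, hκ2⟩ := exists_between hl
  have h1 : ∀ᶠ z in nhds (Q : ℂ), ‖φ z - Q‖ ≤ ‖z - Q‖ := by
    have h2 := (hasDerivAt_iff_isLittleO.1 hφd).def (sub_pos.2 hκ1)
    filter_upwards [h2] with z hz
    rw [hφQ] at hz
    calc ‖φ z - Q‖ = ‖(φ z - Q - (z - Q) • l) + (z - Q) • l‖ := by congr 1; ring
      _ ≤ (κ - ‖l‖) * ‖z - Q‖ + ‖z - Q‖ * ‖l‖ := by
          refine (norm_add_le _ _).trans (add_le_add hz (norm_smul_le _ _))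
      _ ≤ ‖z - Q‖ := by nlinarith [norm_nonneg (z - Q)]
  have h2 : ∀ᶠ z in nhds (Q : ℂ), ∀ i ∈ Finset.range n, ((arnoldC τ ε)^[i] z).re ∈ U := by
    rw [Filter.eventually_all_finset]
    intro i _
    have hc : Continuous fun z => ((arnoldC τ ε)^[i] z).re :=
      Complex.continuous_re.comp ((arnoldC_continuous τ ε).iterate i)
    exact hc.continuousAt.eventually (hU.mem_nhds (hQU i))
  obtain ⟨r, hr, hball⟩ := Metric.eventually_nhds_iff_ball.1 (h1.and h2)
  have hφball : ∀ a, ∀ z ∈ Metric.ball (Q : ℂ) r, φ^[a] z ∈ Metric.ball (Q : ℂ) r := by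
    intro a
    induction a with
    | zero => exact fun z hz => hz
    | succ a ih =>
      intro z hz
      refine ih _ (mem_ball_iff_norm.2 (((hball z hz).1).trans_lt (mem_ball_iff_norm.1 hz)))
  refine ⟨{w | ∃ (j : ℕ) (m : ℤ), ∃ z ∈ Metric.ball (Q : ℂ) r, w = (arnoldC τ ε)^[j] z + m},
    r, hr, fun z hz => ⟨0, 0, z, hz, by simp⟩, ?_, ?_, ?_, ?_⟩
  · rintro _ ⟨j, m, z, hz, rfl⟩
    exact ⟨j + 1, m, z, hz, by rw [arnoldC_add_int, iterate_succ_apply']⟩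
  · rintro _ ⟨j, m, z, hz, rfl⟩
    refine ⟨j, m, starRingEnd ℂ z, ?_, by rw [arnoldC_iterate_conj]; simp⟩
    rw [mem_ball_iff_norm] at hz ⊢
    rw [← Complex.conj_ofReal, ← map_sub, RCLike.norm_conj]
    exact hz
  · rintro _ ⟨j, m, z, hz, rfl⟩ i
    exact ⟨j, m + i, z, hz, by push_cast; ring⟩
  · rintro _ ⟨j, m, z, hz, rfl⟩
    have h3 := (hball _ (hφball (j / n) z hz)).2 (j % n) (Finset.mem_range.2 (Nat.mod_lt _ hn))
    have h4 : (arnoldC τ ε)^[j] z = (arnoldC τ ε)^[j % n] (φ^[j / n] z) + ((j / n : ℕ) * k : ℤ) := by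
      conv_lhs => rw [← Nat.mod_add_div j n]
      rw [iterate_add_apply, arnoldC_iterate_mul τ ε n (j / n) k, arnoldC_iterate_add_int]
    rw [h4, Complex.add_re, Complex.add_re, Complex.intCast_re, Complex.intCast_re]
    exact hUk _ (hUk _ h3 _) _

/-- The Arnol'd map cannot have attracting cycles in two disjoint open sets. -/
lemma arnoldC_not_two_attractors {τ ε : ℝ} (hε : 0 < ε) (hεπ : 2 * π * ε < 1) {U V : Set ℝ}
    (hU : IsOpen U) (hV : IsOpen V) (hUV : Disjoint U V)
    (hUk : ∀ x ∈ U, ∀ k : ℤ, x + k ∈ U) (hVk : ∀ x ∈ V, ∀ k : ℤ, x + k ∈ V)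
    {n n' : ℕ} (hn : 0 < n) (hn' : 0 < n') {k k' : ℤ} {Q P : ℝ}
    (hQ : (arnoldC τ ε)^[n] Q = Q + k) (hP : (arnoldC τ ε)^[n'] P = P + k') {l l' : ℂ}
    (hl : ‖l‖ < 1) (hl' : ‖l'‖ < 1) (hderQ : HasDerivAt (arnoldC τ ε)^[n] l Q)
    (hderP : HasDerivAt (arnoldC τ ε)^[n'] l' P) (hQU : ∀ i, ((arnoldC τ ε)^[i] Q).re ∈ U)
    (hPV : ∀ i, ((arnoldC τ ε)^[i] P).re ∈ V) : False := by
  obtain ⟨N₁, r, hr, hb, hf, hc, hi, hre⟩ := arnoldC_exists_trap hU hUk hn hQ hl hderQ hQU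
  obtain ⟨N₂, r', hr', hb', hf', hc', hi', hre'⟩ := arnoldC_exists_trap hV hVk hn' hP hl' hderP hPV
  have hdisj : Disjoint N₁ N₂ := disjoint_left.2 fun z hz hz' =>
    disjoint_left.1 hUV (hre z hz) (hre' z hz')
  obtain ⟨c, hc0, M, hM⟩ := arnoldC_critical_mem_basin hε hr hr' hb hb' hdisj hf' hi' hQ hl hderQ
  obtain ⟨c', hc0', M', hM'⟩ :=
    arnoldC_critical_mem_basin hε hr' hr hb' hb hdisj.symm hf hi hP hl' hderP
  have hcM : (arnoldC τ ε)^[M'] c ∈ N₂ := by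
    obtain ⟨j, hj | hj⟩ := arnoldC_critical_points hε hεπ hc0 hc0'
    · rw [hj, arnoldC_iterate_add_int]; exact hi' _ hM' _
    · rw [hj, arnoldC_iterate_add_int, arnoldC_iterate_conj]; exact hi' _ (hc' _ hM') _
  have hfit : ∀ m, ∀ z ∈ N₁, (arnoldC τ ε)^[m] z ∈ N₁ := fun m => by
    induction m with
    | zero => exact fun z hz => hz
    | succ m ih => exact fun z hz => ih _ (hf z hz)
  have hfit' : ∀ m, ∀ z ∈ N₂, (arnoldC τ ε)^[m] z ∈ N₂ := fun m => by
    induction m with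
    | zero => exact fun z hz => hz
    | succ m ih => exact fun z hz => ih _ (hf' z hz)
  have h1 := hfit M' _ hM
  have h2 := hfit' M _ hcM
  rw [← iterate_add_apply] at h1 h2
  rw [add_comm] at h2
  exact disjoint_left.1 hdisj h1 h2

/-- The lift to `ℝ` of the noiseless Arnol'd circle map. -/
def arnoldR (τ ε x : ℝ) : ℝ := x + τ - ε * Real.sin (2 * π * x)

lemma arnoldC_ofReal (τ ε x : ℝ) : arnoldC τ ε x = (arnoldR τ ε x : ℂ) := by
  simp [arnoldC, arnoldR]

lemma arnoldC_iterate_ofReal (τ ε x : ℝ) (n : ℕ) :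
    (arnoldC τ ε)^[n] x = ((arnoldR τ ε)^[n] x : ℂ) := by
  induction n generalizing x with
  | zero => rfl
  | succ n ih => rw [iterate_succ_apply, iterate_succ_apply, arnoldC_ofReal, ih]

lemma arnoldR_hasDerivAt (τ ε x : ℝ) :
    HasDerivAt (arnoldR τ ε) (1 - ε * (2 * π * Real.cos (2 * π * x))) x := by
  have h1 : HasDerivAt (fun x : ℝ => 2 * π * x) (2 * π) x := by
    simpa using (hasDerivAt_id x).const_mul (2 * π)
  have h2 := ((Real.hasDerivAt_sin (2 * π * x)).comp x h1).const_mul ε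
  have h3 := ((hasDerivAt_id x).add_const τ).sub h2
  rw [show 1 - ε * (2 * π * Real.cos (2 * π * x)) = 1 - ε * (Real.cos (2 * π * x) * (2 * π)) by ring]
  exact h3

lemma arnoldR_deriv_pos {ε : ℝ} (hε : 0 < ε) (hεπ : 2 * π * ε < 1) (x : ℝ) :
    0 < 1 - ε * (2 * π * Real.cos (2 * π * x)) := by
  have h5 := Real.cos_le_one (2 * π * x)
  have h6 : 0 < 2 * π * ε := by positivity
  nlinarith

lemma arnoldR_continuous (τ ε : ℝ) : Continuous (arnoldR τ ε) :=
  continuous_iff_continuousAt.2 fun x => (arnoldR_hasDerivAt τ ε x).continuousAt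

lemma arnoldR_strictMono {ε : ℝ} (hε : 0 < ε) (hεπ : 2 * π * ε < 1) (τ : ℝ) :
    StrictMono (arnoldR τ ε) :=
  strictMono_of_hasDerivAt_pos (arnoldR_hasDerivAt τ ε) (arnoldR_deriv_pos hε hεπ)

lemma arnoldR_add_int (τ ε x : ℝ) (k : ℤ) : arnoldR τ ε (x + k) = arnoldR τ ε x + k := by
  simp only [arnoldR]
  rw [show 2 * π * (x + k) = 2 * π * x + k * (2 * π) by ring, Real.sin_add_int_mul_two_pi]
  ring

lemma arnoldC_iterate_hasDerivAt {τ ε x d : ℝ} {n : ℕ} (h : HasDerivAt (arnoldR τ ε)^[n] d x) :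
    HasDerivAt (arnoldC τ ε)^[n] (d : ℂ) x := by
  have h1 : DifferentiableAt ℂ (arnoldC τ ε)^[n] x := (arnoldC_differentiable τ ε).iterate n x
  have h2 := h1.hasDerivAt.comp_ofReal
  simp only [arnoldC_iterate_ofReal] at h2
  rw [← h2.unique h.ofReal_comp]
  exact h1.hasDerivAt

lemma arnoldR_iterate_sub_le {ε : ℝ} (hε : 0 < ε) (hεπ : 2 * π * ε < 1) {τ τ' : ℝ} (h : τ ≤ τ')
    (n : ℕ) (x : ℝ) :
    (arnoldR τ ε)^[n] x ≤ (arnoldR τ' ε)^[n] x ∧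
      τ' - τ ≤ (arnoldR τ' ε)^[n + 1] x - (arnoldR τ ε)^[n + 1] x := by
  have key : ∀ m, (arnoldR τ ε)^[m] x ≤ (arnoldR τ' ε)^[m] x →
      τ' - τ ≤ (arnoldR τ' ε)^[m + 1] x - (arnoldR τ ε)^[m + 1] x := by
    intro m hm
    have h1 := (arnoldR_strictMono hε hεπ τ').monotone hm
    rw [iterate_succ_apply', iterate_succ_apply']
    simp only [arnoldR] at h1 ⊢
    linarith
  have h2 : (arnoldR τ ε)^[n] x ≤ (arnoldR τ' ε)^[n] x := by
    induction n with
    | zero => rfl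
    | succ n ih => linarith [key n ih]
  exact ⟨h2, key n h2⟩

lemma arnoldR_iterate_abs_sub_le {ε : ℝ} (hε : 0 < ε) (hεπ : 2 * π * ε < 1) (τ τ' : ℝ)
    {n : ℕ} (hn : 0 < n) (x : ℝ) :
    |τ - τ'| ≤ |(arnoldR τ ε)^[n] x - (arnoldR τ' ε)^[n] x| := by
  obtain ⟨m, rfl⟩ := Nat.exists_eq_add_of_lt hn
  rw [zero_add]
  rcases le_total τ τ' with h | h
  · have := (arnoldR_iterate_sub_le hε hεπ h m x).2
    rw [abs_sub_comm, abs_sub_comm (_^[_] _)]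
    exact (le_of_eq (abs_of_nonneg (sub_nonneg.2 h))).trans (this.trans (le_abs_self _))
  · have := (arnoldR_iterate_sub_le hε hεπ h m x).2
    exact (le_of_eq (abs_of_nonneg (sub_nonneg.2 h))).trans (this.trans (le_abs_self _))

/-- The set of parameters with a parabolic cycle of given type is negligible. -/
lemma volume_arnoldR_parabolic {ε : ℝ} (hε : 0 < ε) (hεπ : 2 * π * ε < 1) {n : ℕ} (hn : 0 < n)
    (k : ℤ) :
    volume {τ | ∃ x, (arnoldR τ ε)^[n] x = x + k ∧ HasDerivAt (arnoldR τ ε)^[n] 1 x} = 0 := by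
  set X : Set ℝ :=
    {x | ∃ τ, (arnoldR τ ε)^[n] x = x + k ∧ HasDerivAt (arnoldR τ ε)^[n] 1 x} with hX
  choose! t ht1 ht2 using fun x (hx : x ∈ X) => hx
  have hle : ∀ x₀ ∈ X, ∀ x, ∀ τ, (arnoldR τ ε)^[n] x = x + k →
      |τ - t x₀| ≤ |(arnoldR (t x₀) ε)^[n] x - (arnoldR (t x₀) ε)^[n] x₀ - (x - x₀)| := by
    intro x₀ h₀ x τ h
    refine (arnoldR_iterate_abs_sub_le hε hεπ τ (t x₀) hn x).trans (le_of_eq ?_)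
    rw [h, ht1 x₀ h₀, abs_sub_comm]
    congr 1; ring
  have hsub : {τ | ∃ x, (arnoldR τ ε)^[n] x = x + k ∧ HasDerivAt (arnoldR τ ε)^[n] 1 x} ⊆ t '' X := by
    rintro τ ⟨x, h1, h2⟩
    have hx : x ∈ X := ⟨τ, h1, h2⟩
    refine ⟨x, hx, ?_⟩
    have := hle x hx x τ h1
    simp only [sub_self, abs_zero, abs_nonpos_iff] at this
    linarith
  refine measure_mono_null hsub ?_
  refine addHaar_image_eq_zero_of_det_fderivWithin_eq_zero volume (f' := fun _ => 0) ?_ ?_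
  · intro x₀ h₀
    have h1 := (hasDerivAt_iff_isLittleO.1 (ht2 x₀ h₀))
    rw [hasFDerivWithinAt_iff_isLittleO]
    refine Asymptotics.IsLittleO.of_bound fun c hc => ?_
    filter_upwards [(h1.def hc).filter_mono nhdsWithin_le_nhds, self_mem_nhdsWithin] with x hx hxX
    have h2 := hle x₀ h₀ x (t x) (ht1 x hxX)
    simp only [smul_eq_mul, mul_one, Real.norm_eq_abs] at hx
    simp only [zero_apply, sub_zero, Real.norm_eq_abs]
    exact h2.trans hx
  · intro x _
    simp [ContinuousLinearMap.det]

lemma exists_arnoldR_no_parabolic {ε : ℝ} (hε : 0 < ε) (hεπ : 2 * π * ε < 1) {a b : ℝ}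
    (hab : a < b) :
    ∃ τ ∈ Ioo a b, ∀ n : ℕ, 0 < n → ∀ k : ℤ, ∀ x, (arnoldR τ ε)^[n] x = x + k →
      ¬ HasDerivAt (arnoldR τ ε)^[n] 1 x := by
  by_contra! hcon
  have h1 : volume (⋃ (n : {n : ℕ // 0 < n}) (k : ℤ),
      {τ | ∃ x, (arnoldR τ ε)^[n] x = x + k ∧ HasDerivAt (arnoldR τ ε)^[n] 1 x}) = 0 :=
    measure_iUnion_null fun n => measure_iUnion_null fun k =>
      volume_arnoldR_parabolic hε hεπ n.2 k
  have h2 : volume (Ioo a b) = 0 := by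
    refine measure_mono_null (fun τ hτ => ?_) h1
    obtain ⟨n, hn, k, x, hx⟩ := hcon τ hτ
    exact mem_iUnion.2 ⟨⟨n, hn⟩, mem_iUnion.2 ⟨k, x, hx⟩⟩
  rw [Real.volume_Ioo, ENNReal.ofReal_eq_zero] at h2
  linarith

/-- Near-recurrence modulo the integers along any real sequence. -/
lemma exists_lt_abs_sub_sub_int_lt (s : ℕ → ℝ) {δ : ℝ} (hδ : 0 < δ) :
    ∃ i j : ℕ, i < j ∧ ∃ k : ℤ, |s j - s i - k| < δ := by
  obtain ⟨a, _, φ, hφ, hlim⟩ := isCompact_Icc.tendsto_subseq (x := fun i => Int.fract (s i))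
    (s := Icc (0:ℝ) 1) fun i => ⟨Int.fract_nonneg _, (Int.fract_lt_one _).le⟩
  obtain ⟨N, hN⟩ := Metric.cauchySeq_iff.1 hlim.cauchySeq δ hδ
  refine ⟨φ N, φ (N + 1), hφ (Nat.lt_succ_self N), ⌊s (φ (N + 1))⌋ - ⌊s (φ N)⌋, ?_⟩
  have h := hN (N + 1) (Nat.le_succ N) N le_rfl
  simp only [comp_apply, Real.dist_eq, Int.fract] at h
  push_cast
  convert h using 2; ring

/-- A real interval map strictly pushing the endpoints inwards has a fixed point with slope at
most one. -/
lemma exists_fixed_deriv_le_one {φ φ' : ℝ → ℝ} (hd : ∀ x, HasDerivAt φ (φ' x) x) {a b : ℝ}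
    (hab : a < b) (ha : a < φ a) (hb : φ b < b) :
    ∃ x ∈ Ioo a b, φ x = x ∧ φ' x ≤ 1 := by
  have hc : Continuous φ := continuous_iff_continuousAt.2 fun x => (hd x).continuousAt
  obtain ⟨x, ⟨hx1, hx2⟩, hmax⟩ := (isCompact_Icc.inter_right
    (isClosed_le continuous_id hc) : IsCompact (Icc a b ∩ {x | id x ≤ φ x})).exists_isGreatest
      ⟨a, left_mem_Icc.2 hab.le, ha.le⟩
  have hx2 : x ≤ φ x := hx2
  have hxb : x < b := lt_of_le_of_ne hx1.2 (by rintro rfl; linarith)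
  have hgt : ∀ᶠ y in nhdsWithin x (Ioi x), φ y < y := by
    filter_upwards [Ioc_mem_nhdsGT hxb] with y hy
    by_contra! h
    exact absurd (hmax ⟨⟨hx1.1.trans hy.1.le, hy.2⟩, h⟩) (not_le.2 hy.1)
  have hfix : φ x = x := by
    refine le_antisymm ?_ hx2
    have h1 : Tendsto φ (nhdsWithin x (Ioi x)) (nhds (φ x)) :=
      hc.continuousAt.tendsto.mono_left nhdsWithin_le_nhds
    have h2 : Tendsto (fun y => y) (nhdsWithin x (Ioi x)) (nhds x) :=
      tendsto_id.mono_left nhdsWithin_le_nhds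
    exact le_of_tendsto_of_tendsto h1 h2 (hgt.mono fun y hy => hy.le)
  have hxa : a < x := lt_of_le_of_ne hx1.1 (by rintro rfl; linarith)
  refine ⟨x, ⟨hxa, hxb⟩, hfix, ?_⟩
  have hs : Tendsto (slope φ x) (nhdsWithin x (Ioi x)) (nhds (φ' x)) :=
    (hasDerivAt_iff_tendsto_slope.1 (hd x)).mono_left
      (nhdsWithin_mono x (fun y (hy : x < y) => hy.ne'))
  refine le_of_tendsto hs ?_
  filter_upwards [hgt, self_mem_nhdsWithin] with y hy hxy
  have hxy : x < y := hxy
  rw [slope_def_field, hfix, div_le_one (by linarith)]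
  linarith

/-- A trapping region of the noisy map contains an attracting cycle of a nearby noiseless map
without parabolic cycles. -/
lemma arnoldR_exists_attractor {τ τ' ε σ : ℝ} (hε : 0 < ε) (hεπ : 2 * π * ε < 1)
    (hτ' : τ' ∈ Ioo (τ - σ / 2) (τ + σ / 2))
    (hgen : ∀ n : ℕ, 0 < n → ∀ k : ℤ, ∀ x, (arnoldR τ' ε)^[n] x = x + k →
      ¬ HasDerivAt (arnoldR τ' ε)^[n] 1 x)
    {U : Set ℝ} (hU : IsOpen U) (hUk : ∀ x ∈ U, ∀ k : ℤ, x + k ∈ U) (hne : U.Nonempty)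
    (hne' : Uᶜ.Nonempty) (htrap : ∀ x ∈ U, ∀ s ∈ Ioo (-(σ / 2)) (σ / 2), arnoldR τ ε x + s ∈ U) :
    ∃ n : ℕ, 0 < n ∧ ∃ (k : ℤ) (Q d : ℝ), (arnoldC τ' ε)^[n] Q = Q + k ∧
      HasDerivAt (arnoldC τ' ε)^[n] (d : ℂ) Q ∧ ‖(d : ℂ)‖ < 1 ∧
      ∀ i, ((arnoldC τ' ε)^[i] (Q : ℂ)).re ∈ U := by
  set f := arnoldR τ' ε with hf
  have hmono := (arnoldR_strictMono hε hεπ τ').monotone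
  set δ := σ / 2 - |τ' - τ| with hδ
  have hδ0 : 0 < δ := by
    rw [hδ, sub_pos, abs_lt]; constructor <;> linarith [hτ'.1, hτ'.2]
  have hstep : ∀ x ∈ U, ∀ s, |s| < δ → f x + s ∈ U := by
    intro x hx s hs
    have h1 : |τ' - τ + s| < σ / 2 := (abs_add_le _ _).trans_lt (by linarith)
    have h2 := htrap x hx (τ' - τ + s) (abs_lt.1 h1)
    convert h2 using 1
    simp only [hf, arnoldR]; ring
  have hit : ∀ i, ∀ x ∈ U, f^[i] x ∈ U := by
    intro i
    induction i with
    | zero => exact fun x hx => hx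
    | succ i ih => exact fun x hx => ih _ (by simpa using hstep x hx 0 (by simpa))
  obtain ⟨x₀, hx₀⟩ := hne
  obtain ⟨i, j, hij, k, hk⟩ := exists_lt_abs_sub_sub_int_lt (fun i => f^[i] x₀) hδ0
  obtain ⟨n, rfl⟩ := Nat.exists_eq_add_of_lt hij
  set y := f^[i] x₀ with hy
  have hyU : y ∈ U := hit i x₀ hx₀
  set φ : ℝ → ℝ := fun x => f^[n + 1] x - k with hφ
  have hφy : |φ y - y| < δ := by
    convert hk using 2
    simp only [hφ, hy, ← iterate_add_apply, show n + 1 + i = i + n + 1 by ring]; ring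
  have hφU : ∀ x ∈ U, ∀ s, |s| < δ → φ x + s ∈ U := by
    intro x hx s hs
    have h1 := hUk _ (hstep _ (hit n x hx) s hs) (-k)
    convert h1 using 1
    simp only [hφ, iterate_succ_apply']; push_cast; ring
  have hφc : Continuous φ := ((arnoldR_continuous τ' ε).iterate (n + 1)).sub continuous_const
  obtain ⟨c, hc⟩ := hne'
  have hck : ∀ l : ℤ, c + l ∉ U := fun l h => hc (by simpa using hUk _ h (-l))
  have hcl : IsClosed Uᶜ := hU.isClosed_compl
  obtain ⟨a, ⟨ha1, ha2⟩, hamax⟩ : ∃ a, IsGreatest (Uᶜ ∩ Iic y) a := by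
    have hS : IsClosed (Uᶜ ∩ Iic y) := hcl.inter isClosed_Iic
    have hne : (Uᶜ ∩ Iic y).Nonempty := ⟨c + ⌊y - c⌋, hck _, by
      have := Int.floor_le (y - c); simp only [mem_Iic]; linarith⟩
    have hb : BddAbove (Uᶜ ∩ Iic y) := ⟨y, fun x hx => hx.2⟩
    exact ⟨_, hS.csSup_mem hne hb, fun x hx => le_csSup hb hx⟩
  obtain ⟨b, ⟨hb1, hb2⟩, hbmin⟩ : ∃ b, IsLeast (Uᶜ ∩ Ici y) b := by
    have hS : IsClosed (Uᶜ ∩ Ici y) := hcl.inter isClosed_Ici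
    have hne : (Uᶜ ∩ Ici y).Nonempty := ⟨c + ⌈y - c⌉, hck _, by
      have := Int.le_ceil (y - c); simp only [mem_Ici]; linarith⟩
    have hb : BddBelow (Uᶜ ∩ Ici y) := ⟨y, fun x hx => hx.2⟩
    exact ⟨_, hS.csInf_mem hne hb, fun x hx => csInf_le hb hx⟩
  have hay : a < y := lt_of_le_of_ne ha2 (by rintro h; exact ha1 (h ▸ hyU))
  have hyb : y < b := lt_of_le_of_ne hb2 (by rintro h; exact hb1 (h ▸ hyU))
  have hJ : Ioo a b ⊆ U := by
    intro x hx
    by_contra hxU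
    rcases le_total x y with h | h
    · exact absurd (hamax ⟨hxU, h⟩) (not_le.2 hx.1)
    · exact absurd (hbmin ⟨hxU, h⟩) (not_le.2 hx.2)
  have hconn : IsPreconnected (Ioo a b ×ˢ Ioo (-δ) δ) := isPreconnected_Ioo.prod isPreconnected_Ioo
  have hcont : ContinuousOn (fun p : ℝ × ℝ => φ p.1 + p.2) (Ioo a b ×ˢ Ioo (-δ) δ) := by fun_prop
  have him : ∀ p ∈ Ioo a b ×ˢ Ioo (-δ) δ, φ p.1 + p.2 ∈ U := fun p hp =>
    hφU _ (hJ hp.1) _ (abs_lt.2 hp.2)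
  have hbase : ((y, y - φ y) : ℝ × ℝ) ∈ Ioo a b ×ˢ Ioo (-δ) δ := by
    refine ⟨⟨hay, hyb⟩, ?_⟩
    rw [abs_sub_comm] at hφy
    exact abs_lt.1 hφy
  have hhi : ∀ p ∈ Ioo a b ×ˢ Ioo (-δ) δ, φ p.1 + p.2 < b := by
    intro p hp
    by_contra! h
    obtain ⟨q, hq, hqb⟩ := hconn.intermediate_value hbase hp hcont
      (show b ∈ Icc _ _ from ⟨by simpa using hyb.le, h⟩)
    exact hb1 (hqb ▸ him q hq)
  have hlo : ∀ p ∈ Ioo a b ×ˢ Ioo (-δ) δ, a < φ p.1 + p.2 := by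
    intro p hp
    by_contra! h
    obtain ⟨q, hq, hqb⟩ := hconn.intermediate_value hp hbase hcont
      (show a ∈ Icc _ _ from ⟨h, by simpa using hay.le⟩)
    exact ha1 (hqb ▸ him q hq)
  have hend : ∀ x, x = a ∨ x = b → φ x + δ / 2 ∈ Icc a b ∧ φ x - δ / 2 ∈ Icc a b := by
    intro x hx
    have hx' : x ∈ closure (Ioo a b) := by
      rw [closure_Ioo (hay.trans hyb).ne]
      rcases hx with rfl | rfl
      · exact left_mem_Icc.2 (hay.trans hyb).le
      · exact right_mem_Icc.2 (hay.trans hyb).le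
    have key : ∀ s ∈ Ioo (-δ) δ, φ x + s ∈ Icc a b := fun s hs =>
      closure_minimal (s := Ioo a b) (t := (fun x => φ x + s) ⁻¹' Icc a b)
        (fun z hz => ⟨(hlo (z, s) ⟨hz, hs⟩).le, (hhi (z, s) ⟨hz, hs⟩).le⟩)
        (isClosed_Icc.preimage (hφc.add continuous_const)) hx'
    exact ⟨key _ ⟨by linarith, by linarith⟩, by
      simpa [sub_eq_add_neg] using key (-(δ / 2)) ⟨by linarith, by linarith⟩⟩
  have hfd : Differentiable ℝ f := fun x => (arnoldR_hasDerivAt τ' ε x).differentiableAt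
  have hdiff : ∀ x, HasDerivAt φ (deriv f^[n + 1] x) x := fun x =>
    ((hfd.iterate (n + 1)) x).hasDerivAt.sub_const _
  obtain ⟨Q, hQ, hQfix, hQd⟩ := exists_fixed_deriv_le_one hdiff (hay.trans hyb)
    (by linarith [(hend a (Or.inl rfl)).2.1]) (by linarith [(hend b (Or.inr rfl)).1.2])
  have hfQ : f^[n + 1] Q = Q + k := by
    have := hQfix; simp only [hφ] at this; linarith
  have hderiv : HasDerivAt f^[n + 1] (deriv f^[n + 1] Q) Q := ((hfd.iterate (n + 1)) Q).hasDerivAt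
  have hd0 : 0 ≤ deriv f^[n + 1] Q := (hmono.iterate (n + 1)).deriv_nonneg
  have hd1 : deriv f^[n + 1] Q ≠ 1 := fun h =>
    hgen (n + 1) n.succ_pos k Q hfQ (h ▸ hderiv)
  refine ⟨n + 1, n.succ_pos, k, Q, deriv f^[n + 1] Q, ?_, arnoldC_iterate_hasDerivAt hderiv, ?_, ?_⟩
  · rw [arnoldC_iterate_ofReal, ← hf, hfQ]; push_cast; rfl
  · rw [Complex.norm_real, Real.norm_eq_abs, abs_of_nonneg hd0]
    exact lt_of_le_of_ne hQd hd1
  · intro i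
    rw [arnoldC_iterate_ofReal, Complex.ofReal_re]
    exact hit i Q (hJ hQ)

/-- The noisy map does not have two disjoint trapping regions. -/
lemma arnoldR_not_two_traps {τ ε σ : ℝ} (hε : 0 < ε) (hεπ : 2 * π * ε < 1) (hσ : 0 < σ)
    {U V : Set ℝ} (hU : IsOpen U) (hV : IsOpen V) (hUV : Disjoint U V)
    (hUk : ∀ x ∈ U, ∀ k : ℤ, x + k ∈ U) (hVk : ∀ x ∈ V, ∀ k : ℤ, x + k ∈ V)
    (hUne : U.Nonempty) (hVne : V.Nonempty)
    (hUt : ∀ x ∈ U, ∀ s ∈ Ioo (-(σ / 2)) (σ / 2), arnoldR τ ε x + s ∈ U)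
    (hVt : ∀ x ∈ V, ∀ s ∈ Ioo (-(σ / 2)) (σ / 2), arnoldR τ ε x + s ∈ V) : False := by
  obtain ⟨τ', hτ', hgen⟩ := exists_arnoldR_no_parabolic hε hεπ
    (show τ - σ / 2 < τ + σ / 2 by linarith)
  obtain ⟨n, hn, k, Q, d, h1, h2, h3, h4⟩ := arnoldR_exists_attractor hε hεπ hτ' hgen hU hUk hUne
    (hVne.mono hUV.symm.subset_compl_right) hUt
  obtain ⟨n', hn', k', Q', d', h1', h2', h3', h4'⟩ := arnoldR_exists_attractor hε hεπ hτ' hgen hV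
    hVk hVne (hUne.mono hUV.subset_compl_right) hVt
  exact arnoldC_not_two_attractors hε hεπ hU hV hUV hUk hVk hn hn' h1 h1' h3 h3' h2 h2' h4 h4'

instance nuI_isProbabilityMeasure : IsProbabilityMeasure nuI := ⟨by
  rw [nuI, Measure.restrict_apply_univ, Real.volume_Icc]; norm_num⟩

/-- Continuous functions on the circle. -/
abbrev CircleFun := C(AddCircle (1:ℝ), ℝ)

/-- The averaging operator `u ↦ ∫ u(· + c + s w) dν(w)`. -/
def circleAvg (c s : ℝ) : CircleFun →L[ℝ] CircleFun :=
  LinearMap.mkContinuous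
    { toFun := fun u => ⟨fun x => ∫ w, u (x + (↑(c + s * w) : AddCircle (1:ℝ))) ∂nuI,
        continuous_parametric_integral_of_continuous (by
          have h : Continuous fun p : AddCircle (1:ℝ) × ℝ =>
            p.1 + (↑(c + s * p.2) : AddCircle (1:ℝ)) :=
              continuous_fst.add ((AddCircle.continuous_mk' 1).comp (by fun_prop))
          exact u.continuous.comp h) isCompact_Icc⟩
      map_add' := fun u v => by
        ext x
        have h : Continuous fun w : ℝ => x + (↑(c + s * w) : AddCircle (1:ℝ)) :=
          continuous_const.add ((AddCircle.continuous_mk' 1).comp (by fun_prop))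
        exact integral_add ((u.continuous.comp h).integrableOn_Icc)
          ((v.continuous.comp h).integrableOn_Icc)
      map_smul' := fun a u => by
        ext x
        exact integral_const_mul _ _ } 1 (fun u => by
    rw [one_mul, ContinuousMap.norm_le _ (norm_nonneg _)]
    intro x
    refine (norm_integral_le_of_norm_le_const (C := ‖u‖)
      (Eventually.of_forall fun w => u.norm_coe_le_norm _)).trans ?_
    simp)

lemma circleAvg_apply (c s : ℝ) (u : CircleFun) (x : AddCircle (1:ℝ)) :
    circleAvg c s u x = ∫ w, u (x + (↑(c + s * w) : AddCircle (1:ℝ))) ∂nuI := rfl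

lemma continuous_comp_coe (u : CircleFun) : Continuous fun y : ℝ => u y :=
  u.continuous.comp (AddCircle.continuous_mk' 1)

lemma circleAvg_apply_coe (c : ℝ) {s : ℝ} (hs : s ≠ 0) (u : CircleFun) (y : ℝ) :
    circleAvg c s u y = s⁻¹ * ∫ t in (y + c - s / 2)..(y + c + s / 2), u t := by
  rw [circleAvg_apply, nuI, integral_Icc_eq_integral_Ioc,
    ← intervalIntegral.integral_of_le (by norm_num)]
  have := intervalIntegral.integral_comp_add_mul (a := -(1/2)) (b := 1/2)
    (fun t : ℝ => u (t : AddCircle (1:ℝ))) hs (y + c)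
  rw [show y + c - s / 2 = y + c + s * (-(1/2)) by ring,
    show y + c + s / 2 = y + c + s * (1/2) by ring, ← smul_eq_mul, ← this]
  congr 1
  ext w
  rw [← AddCircle.coe_add, add_assoc]

lemma circleAvg_sub_le (c c' : ℝ) {s : ℝ} (hs : s ≠ 0) (u : CircleFun) (x : AddCircle (1:ℝ)) :
    |circleAvg c s u x - circleAvg c' s u x| ≤ 2 * |s|⁻¹ * ‖u‖ * |c - c'| := by
  induction x using QuotientAddGroup.induction_on with
  | H y =>
  rw [circleAvg_apply_coe c hs, circleAvg_apply_coe c' hs, ← mul_sub]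
  have hi : ∀ a b : ℝ, IntervalIntegrable (fun t : ℝ => u (t : AddCircle (1:ℝ))) volume a b :=
    fun a b => (continuous_comp_coe u).intervalIntegrable a b
  have hb : ∀ a b : ℝ, |∫ t in a..b, u (t : AddCircle (1:ℝ))| ≤ ‖u‖ * |b - a| := fun a b =>
    intervalIntegral.norm_integral_le_of_norm_le_const fun t _ => u.norm_coe_le_norm _
  rw [intervalIntegral.integral_interval_sub_interval_comm (hi _ _) (hi _ _) (hi _ _), abs_mul,
    abs_inv]
  have h1 := hb (y + c - s / 2) (y + c' - s / 2)
  have h2 := hb (y + c + s / 2) (y + c' + s / 2)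
  rw [show y + c' - s / 2 - (y + c - s / 2) = -(c - c') by ring, abs_neg] at h1
  rw [show y + c' + s / 2 - (y + c + s / 2) = -(c - c') by ring, abs_neg] at h2
  calc _ ≤ |s|⁻¹ * (‖u‖ * |c - c'| + ‖u‖ * |c - c'|) := by
        gcongr
        exact (abs_sub _ _).trans (add_le_add h1 h2)
    _ = _ := by ring

lemma circleAvg_add_coe (c s t : ℝ) (u : CircleFun) (x : AddCircle (1:ℝ)) :
    circleAvg c s u (x + t) = circleAvg (c + t) s u x := by
  rw [circleAvg_apply, circleAvg_apply]
  congr 1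
  ext w
  congr 1
  rw [add_assoc, ← AddCircle.coe_add]
  congr 2; ring

lemma continuous_circleAvg {s : ℝ} (hs : s ≠ 0) : Continuous fun c => circleAvg c s := by
  have h : LipschitzWith (Real.toNNReal (2 * |s|⁻¹)) fun c => circleAvg c s := by
    refine LipschitzWith.of_dist_le_mul fun c c' => ?_
    rw [Real.coe_toNNReal _ (by positivity), dist_eq_norm, Real.dist_eq]
    refine ContinuousLinearMap.opNorm_le_bound _ (by positivity) fun u => ?_
    rw [ContinuousMap.norm_le _ (by positivity)]
    intro x
    refine (circleAvg_sub_le c c' hs u x).trans (le_of_eq ?_)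
    ring
  exact h.continuous

/-- Uniformly bounded and uniformly Lipschitz functions on the circle form a compact set. -/
lemma isCompact_circle_lipschitz (M : ℝ) : IsCompact {u : CircleFun |
    ∀ x, |u x| ≤ 1 ∧ ∀ t : ℝ, |u (x + t) - u x| ≤ M * |t|} := by
  let e := ContinuousMap.isometryEquivBoundedOfCompact (AddCircle (1:ℝ)) ℝ
  let A : Set (BoundedContinuousFunction (AddCircle (1:ℝ)) ℝ) :=
    {u | ∀ x, |u x| ≤ 1 ∧ ∀ t : ℝ, |u (x + t) - u x| ≤ M * |t|}
  have hA : IsCompact A := by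
    refine BoundedContinuousFunction.arzela_ascoli₂ (Icc (-1) 1) isCompact_Icc A ?_
      (fun f x hf => abs_le.1 (hf x).1) ?_
    · have h : ∀ x, Continuous fun u : BoundedContinuousFunction (AddCircle (1:ℝ)) ℝ => u x :=
        fun x => continuous_eval_const x
      have hA : A = ⋂ x, ({u | |u x| ≤ 1} ∩ ⋂ t : ℝ, {u | |u (x + t) - u x| ≤ M * |t|}) := by
        ext u; simp [A]
      rw [hA]
      exact isClosed_iInter fun x => (isClosed_le (h x).abs continuous_const).inter
        (isClosed_iInter fun t => isClosed_le ((h _).sub (h _)).abs continuous_const)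
    · intro x
      rw [Metric.equicontinuousAt_iff]
      intro η hη
      have h1 : ∀ᶠ t : ℝ in nhds 0, M * |t| < η := by
        have : ContinuousAt (fun t : ℝ => M * |t|) 0 := by fun_prop
        refine this.eventually_lt continuousAt_const (by simpa)
      obtain ⟨r, hr, hball⟩ := Metric.eventually_nhds_iff.1 h1
      have h2 : (fun t : ℝ => x + (t : AddCircle (1:ℝ))) '' Metric.ball 0 r ∈ nhds x := by
        have ho : IsOpenMap fun t : ℝ => x + (t : AddCircle (1:ℝ)) :=
          (isOpenMap_add_left x).comp QuotientAddGroup.isOpenMap_coe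
        refine (ho _ Metric.isOpen_ball).mem_nhds ⟨0, Metric.mem_ball_self hr, by simp⟩
      obtain ⟨ρ, hρ, hsub⟩ := Metric.mem_nhds_iff.1 h2
      refine ⟨ρ, hρ, fun y hy u => ?_⟩
      obtain ⟨t, ht, rfl⟩ := hsub hy
      rw [dist_comm, Real.dist_eq]
      exact ((u.2 x).2 t).trans_lt (hball ht)
  exact e.toHomeomorph.isCompact_preimage.2 hA

lemma isCompactOperator_circleAvg (c : ℝ) {s : ℝ} (hs : s ≠ 0) :
    IsCompactOperator (circleAvg c s) := by
  refine (isCompactOperator_iff_image_closedBall_subset_compact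
    (circleAvg c s : CircleFun →ₗ[ℝ] CircleFun) one_pos).2 ⟨_, isCompact_circle_lipschitz (2 * |s|⁻¹), ?_⟩
  rintro _ ⟨u, hu, rfl⟩ x
  rw [mem_closedBall_zero_iff] at hu
  refine ⟨?_, fun t => ?_⟩
  · refine ((circleAvg c s u).norm_coe_le_norm x).trans ((ContinuousLinearMap.le_of_opNorm_le _
      (LinearMap.mkContinuous_norm_le _ zero_le_one _) u).trans (by simpa))
  · change |circleAvg c s u (x + t) - circleAvg c s u x| ≤ _
    rw [circleAvg_add_coe]
    refine (circleAvg_sub_le _ c hs u x).trans ?_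
    rw [add_sub_cancel_left]
    exact mul_le_mul_of_nonneg_right (mul_le_of_le_one_right (by positivity) hu) (abs_nonneg _)

/-- The continuous map on the circle induced by a continuous `1`-periodic map. -/
def circleLift {Z : Type*} [TopologicalSpace Z] (f : ℝ → Z) (hp : Periodic f 1)
    (hc : Continuous f) : C(AddCircle (1:ℝ), Z) :=
  ⟨hp.lift, (QuotientAddGroup.isQuotientMap_mk _).continuous_iff.2 hc⟩

lemma circleFun_integrable (u : CircleFun) (m : Measure (AddCircle (1:ℝ))) [IsFiniteMeasure m] :
    Integrable u m :=
  u.continuous.integrable_of_hasCompactSupport (HasCompactSupport.of_compactSpace u)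

instance : IsProbabilityMeasure (volume : Measure (AddCircle (1:ℝ))) := ⟨by
  rw [AddCircle.measure_univ]; simp⟩

/-- The projection of a continuous function onto its mean. -/
def circleMean : CircleFun →L[ℝ] CircleFun :=
  LinearMap.mkContinuous
    { toFun := fun u => ContinuousMap.const _ (∫ x, u x)
      map_add' := fun u v => by
        ext x
        exact integral_add (circleFun_integrable u _) (circleFun_integrable v _)
      map_smul' := fun a u => by
        ext x
        exact integral_const_mul _ _ } 1 (fun u => by
    rw [one_mul, ContinuousMap.norm_le _ (norm_nonneg _)]
    intro x
    refine (norm_integral_le_of_norm_le_const (C := ‖u‖)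
      (Eventually.of_forall fun w => u.norm_coe_le_norm _)).trans ?_
    simp)

lemma circleMean_apply (u : CircleFun) (x : AddCircle (1:ℝ)) : circleMean u x = ∫ x, u x := rfl

lemma circleAvg_const (c s a : ℝ) :
    circleAvg c s (ContinuousMap.const _ a) = ContinuousMap.const _ a := by
  ext x
  rw [circleAvg_apply]
  simp

lemma circleAvg_circleMean (c s : ℝ) (u : CircleFun) :
    circleAvg c s (circleMean u) = circleMean u := circleAvg_const c s _

lemma isCompactOperator_circleMean : IsCompactOperator circleMean := by
  have h : circleMean = (circleAvg 0 1).comp circleMean := by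
    ext1 u
    exact (circleAvg_circleMean 0 1 u).symm
  rw [h]
  exact (isCompactOperator_circleAvg 0 one_ne_zero).comp_clm circleMean

/-- Composition with a continuous circle map. -/
def circleComp (g : C(AddCircle (1:ℝ), AddCircle (1:ℝ))) : CircleFun →L[ℝ] CircleFun :=
  LinearMap.mkContinuous
    { toFun := fun u => u.comp g
      map_add' := fun _ _ => rfl
      map_smul' := fun _ _ => rfl } 1 (fun u => by
    rw [one_mul, ContinuousMap.norm_le _ (norm_nonneg _)]
    exact fun x => u.norm_coe_le_norm _)

lemma circleComp_apply (g : C(AddCircle (1:ℝ), AddCircle (1:ℝ))) (u : CircleFun)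
    (x : AddCircle (1:ℝ)) : circleComp g u x = u (g x) := rfl

lemma integral_mul_circleAvg (m : Measure (AddCircle (1:ℝ))) [IsFiniteMeasure m] (c s : ℝ)
    (ψ u : CircleFun) : ∫ x, ψ x * circleAvg c s u x ∂m =
      ∫ w, ∫ x, ψ x * u (x + (↑(c + s * w) : AddCircle (1:ℝ))) ∂m ∂nuI := by
  have hc : Continuous (uncurry fun (x : AddCircle (1:ℝ)) (w : ℝ) =>
      ψ x * u (x + (↑(c + s * w) : AddCircle (1:ℝ)))) := by
    have h : Continuous fun p : AddCircle (1:ℝ) × ℝ =>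
      p.1 + (↑(c + s * p.2) : AddCircle (1:ℝ)) :=
        continuous_fst.add ((AddCircle.continuous_mk' 1).comp (by fun_prop))
    exact (ψ.continuous.comp continuous_fst).mul (u.continuous.comp h)
  rw [← integral_integral_swap (f := fun x w => ψ x * u (x + (↑(c + s * w) : AddCircle (1:ℝ))))]
  · congr 1
    ext x
    rw [circleAvg_apply, integral_const_mul]
  · refine Integrable.of_bound hc.aestronglyMeasurable (‖ψ‖ * ‖u‖) (Eventually.of_forall fun p => ?_)
    exact (norm_mul_le _ _).trans (mul_le_mul (ψ.norm_coe_le_norm _) (u.norm_coe_le_norm _)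
      (norm_nonneg _) (norm_nonneg _))

lemma integral_mul_circleAvg_comm (c s : ℝ) (ψ u : CircleFun) :
    ∫ x, ψ x * circleAvg c s u x = ∫ x, circleAvg (-c) (-s) ψ x * u x := by
  rw [integral_mul_circleAvg]
  simp_rw [mul_comm (circleAvg (-c) (-s) ψ _)]
  rw [integral_mul_circleAvg]
  congr 1
  ext w
  rw [← integral_sub_right_eq_self _ (↑(c + s * w) : AddCircle (1:ℝ))]
  congr 1
  ext x
  rw [sub_add_cancel, mul_comm, sub_eq_add_neg, ← AddCircle.coe_neg]
  congr 4; ring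

lemma arnoldR_contDiff (τ ε : ℝ) : ContDiff ℝ (⊤ : ℕ∞) (arnoldR τ ε) := by
  unfold arnoldR; fun_prop

lemma arnoldR_surjective {ε : ℝ} (hε : 0 < ε) (τ : ℝ) : Surjective (arnoldR τ ε) := by
  refine (arnoldR_continuous τ ε).surjective
    (tendsto_atTop_mono (f := fun x => x + (τ - ε)) (fun x => ?_)
      (tendsto_atTop_add_const_right _ _ tendsto_id))
    (tendsto_atBot_mono (f := fun x => x + (τ + ε)) (fun x => ?_)
      (tendsto_atBot_add_const_right _ _ tendsto_id))
  · have := Real.sin_le_one (2 * π * x)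
    simp only [arnoldR]; nlinarith
  · have := Real.neg_one_le_sin (2 * π * x)
    simp only [arnoldR]; nlinarith

/-- The noiseless Arnol'd map (without rotation), as a homeomorphism of the line. -/
def arnoldHomeo {ε : ℝ} (hε : 0 < ε) (hεπ : 2 * π * ε < 1) : ℝ ≃ₜ ℝ :=
  ((arnoldR_strictMono hε hεπ 0).orderIsoOfSurjective _
    (arnoldR_surjective hε 0)).toHomeomorph

section
variable {ε : ℝ} (hε : 0 < ε) (hεπ : 2 * π * ε < 1)

lemma arnoldHomeo_apply (x : ℝ) : arnoldHomeo hε hεπ x = arnoldR 0 ε x := rfl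

lemma arnoldHomeo_symm_contDiff : ContDiff ℝ (⊤ : ℕ∞) (arnoldHomeo hε hεπ).symm :=
  (arnoldHomeo hε hεπ).contDiff_symm_deriv (fun x => (arnoldR_deriv_pos hε hεπ x).ne')
    (arnoldR_hasDerivAt 0 ε) (arnoldR_contDiff 0 ε)

lemma arnoldHomeo_symm_add_one (y : ℝ) :
    (arnoldHomeo hε hεπ).symm (y + 1) = (arnoldHomeo hε hεπ).symm y + 1 := by
  rw [Homeomorph.symm_apply_eq, arnoldHomeo_apply]
  have := arnoldR_add_int 0 ε ((arnoldHomeo hε hεπ).symm y) 1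
  rw [Int.cast_one] at this
  rw [this, ← arnoldHomeo_apply hε hεπ, Homeomorph.apply_symm_apply]

/-- The circle map induced by the inverse of `arnoldHomeo`. -/
def arnoldInv : C(AddCircle (1:ℝ), AddCircle (1:ℝ)) :=
  circleLift (fun y => ((arnoldHomeo hε hεπ).symm y : AddCircle (1:ℝ)))
    (fun y => by
      beta_reduce
      rw [arnoldHomeo_symm_add_one, AddCircle.coe_add_period])
    ((AddCircle.continuous_mk' 1).comp (arnoldHomeo hε hεπ).symm.continuous)

/-- The derivative of the inverse of `arnoldHomeo`. -/
def arnoldInvDeriv : CircleFun :=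
  circleLift (deriv (arnoldHomeo hε hεπ).symm)
    (fun y => by
      rw [← deriv_comp_add_const]
      simp_rw [arnoldHomeo_symm_add_one, deriv_add_const])
    ((arnoldHomeo_symm_contDiff hε hεπ).continuous_deriv (by simp))

/-- The transfer operator of the noiseless Arnol'd map. -/
def arnoldTransfer : CircleFun →L[ℝ] CircleFun :=
  (ContinuousLinearMap.mul ℝ CircleFun (arnoldInvDeriv hε hεπ)).comp
    (circleComp (arnoldInv hε hεπ))

lemma arnoldTransfer_coe (u : CircleFun) (y : ℝ) : arnoldTransfer hε hεπ u y =
    deriv (arnoldHomeo hε hεπ).symm y * u ((arnoldHomeo hε hεπ).symm y : ℝ) := rfl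

/-- The circle map induced by `arnoldR`. -/
def arnoldCircle (ε : ℝ) : C(AddCircle (1:ℝ), AddCircle (1:ℝ)) :=
  circleLift (fun y => (arnoldR 0 ε y : AddCircle (1:ℝ)))
    (fun y => by
      have := arnoldR_add_int 0 ε y 1
      rw [Int.cast_one] at this
      beta_reduce
      rw [this, AddCircle.coe_add_period])
    ((AddCircle.continuous_mk' 1).comp (arnoldR_continuous 0 ε))

lemma integral_mul_arnoldTransfer (ψ v : CircleFun) :
    ∫ x, ψ x * arnoldTransfer hε hεπ v x = ∫ x, circleComp (arnoldCircle ε) ψ x * v x := by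
  set k := (arnoldHomeo hε hεπ).symm with hk
  rw [← AddCircle.intervalIntegral_preimage 1 0, ← AddCircle.intervalIntegral_preimage 1 (k 0)]
  have h1 := intervalIntegral.integral_comp_mul_deriv (a := 0) (b := 0 + 1) (f := k)
    (f' := deriv k) (g := fun x : ℝ => circleComp (arnoldCircle ε) ψ x * v x)
    (fun x _ => (((arnoldHomeo_symm_contDiff hε hεπ).differentiable (by simp)) x).hasDerivAt)
    ((arnoldHomeo_symm_contDiff hε hεπ).continuous_deriv (by simp)).continuousOn
    ((continuous_comp_coe _).mul (continuous_comp_coe _))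
  rw [hk, arnoldHomeo_symm_add_one, ← hk] at h1
  rw [← h1]
  congr 1
  ext y
  have h2 : circleComp (arnoldCircle ε) ψ (k y : ℝ) = ψ (y : AddCircle (1:ℝ)) := by
    rw [circleComp_apply]
    change ψ (arnoldR 0 ε (k y) : ℝ) = _
    rw [← arnoldHomeo_apply hε hεπ, hk, Homeomorph.apply_symm_apply]
  rw [arnoldTransfer_coe, comp_apply, h2, hk]
  ring

/-- The operator `I - L + E`, where `L` is the transfer operator of the noisy map and `E` the
projection onto the mean. -/
def statOp (σ τ : ℝ) : CircleFun →L[ℝ] CircleFun :=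
  1 - (circleAvg (-τ) (-σ)).comp (arnoldTransfer hε hεπ - circleMean)

/-- The Koopman operator of the noisy map. -/
def noisyKoopman (ε σ τ : ℝ) : CircleFun →L[ℝ] CircleFun :=
  (circleComp (arnoldCircle ε)).comp (circleAvg τ σ)

lemma integral_koopman_mul (σ τ : ℝ) (ψ u : CircleFun) :
    ∫ x, noisyKoopman ε σ τ ψ x * u x =
      ∫ x, ψ x * circleAvg (-τ) (-σ) (arnoldTransfer hε hεπ u) x := by
  rw [integral_mul_circleAvg_comm, neg_neg, neg_neg, integral_mul_arnoldTransfer]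
  rfl

lemma integral_statOp (σ τ : ℝ) (ψ u : CircleFun) :
    ∫ x, (1 - noisyKoopman ε σ τ + circleMean) ψ x * u x = ∫ x, ψ x * statOp hε hεπ σ τ u x := by
  have hi : ∀ f g : CircleFun, Integrable (fun x => f x * g x) (volume : Measure (AddCircle (1:ℝ))) :=
    fun f g => circleFun_integrable (f * g) _
  have h1 : ∀ x, (1 - noisyKoopman ε σ τ + circleMean) ψ x * u x =
      ψ x * u x - noisyKoopman ε σ τ ψ x * u x + circleMean ψ x * u x := fun x => by
    simp [add_mul, sub_mul]
  have h2 : ∀ x, ψ x * statOp hε hεπ σ τ u x =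
      ψ x * u x - ψ x * circleAvg (-τ) (-σ) (arnoldTransfer hε hεπ u) x +
        ψ x * circleMean u x := fun x => by
    simp [statOp, circleAvg_circleMean]; ring
  have hsub : ∀ f g f' g' : CircleFun, Integrable (fun x => f x * g x - f' x * g' x)
      (volume : Measure (AddCircle (1:ℝ))) := fun f g f' g' => (hi f g).sub (hi f' g')
  simp_rw [h1, h2]
  rw [integral_add (hsub _ _ _ _) (hi _ _), integral_sub (hi _ _) (hi _ _),
    integral_add (hsub _ _ _ _) (hi _ _), integral_sub (hi _ _) (hi _ _),
    integral_koopman_mul hε hεπ]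
  simp only [circleMean_apply]
  rw [integral_const_mul, integral_mul_const]

end

lemma noisyKoopman_coe (ε σ τ : ℝ) (ψ : CircleFun) (y : ℝ) :
    noisyKoopman ε σ τ ψ y = ∫ w, ψ (arnoldR τ ε y + σ * w : ℝ) ∂nuI := by
  change circleAvg τ σ ψ (arnoldR 0 ε y : ℝ) = _
  rw [circleAvg_apply]
  congr 1
  ext w
  rw [← AddCircle.coe_add]
  congr 2
  simp only [arnoldR]; ring

/-- The maximum set of a function fixed by the Koopman operator is forward invariant. -/
lemma eq_max_of_noisyKoopman_eq {ε σ τ : ℝ} (hσ : 0 < σ) {ψ : CircleFun}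
    (hψ : noisyKoopman ε σ τ ψ = ψ) {M : ℝ} (hM : ∀ x, ψ x ≤ M) {y : ℝ} (hy : ψ y = M) {s : ℝ}
    (hs : s ∈ Icc (-(σ / 2)) (σ / 2)) : ψ (arnoldR τ ε y + s : ℝ) = M := by
  let h : ℝ → ℝ := fun w => M - ψ (arnoldR τ ε y + σ * w : ℝ)
  have hψc : Continuous fun w : ℝ => ψ (arnoldR τ ε y + σ * w : ℝ) :=
    (continuous_comp_coe ψ).comp (by fun_prop)
  have hc : Continuous h := continuous_const.sub hψc
  have h0 : ∫ w, h w ∂nuI = 0 := by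
    have hi : Integrable (fun w : ℝ => ψ (arnoldR τ ε y + σ * w : ℝ)) nuI :=
      hψc.integrableOn_Icc
    simp only [h]
    rw [integral_sub (integrable_const _) hi, ← noisyKoopman_coe, hψ, hy]
    simp
  have h1 := (integral_eq_zero_iff_of_nonneg (fun w => sub_nonneg.2 (hM _))
    hc.integrableOn_Icc).1 h0
  have h2 := Measure.eqOn_Icc_of_ae_eq volume (by norm_num) h1 hc.continuousOn
    continuousOn_const (x := s / σ) ⟨by rw [le_div_iff₀ hσ]; linarith [hs.1],
      by rw [div_le_iff₀ hσ]; linarith [hs.2]⟩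
  simp only [Pi.zero_apply] at h2
  rw [mul_div_cancel₀ _ hσ.ne'] at h2
  linarith

lemma circleFun_exists_max (ψ : CircleFun) : ∃ y : ℝ, ∀ x, ψ x ≤ ψ y := by
  obtain ⟨x, -, hx⟩ := isCompact_univ.exists_isMaxOn univ_nonempty ψ.continuous.continuousOn
  obtain ⟨y, rfl⟩ := QuotientAddGroup.mk_surjective x
  exact ⟨y, fun z => hx (mem_univ z)⟩

/-- The lift to the line of the interior of a level set of a circle function. -/
def levelInterior (ψ : CircleFun) (M : ℝ) : Set ℝ := interior {y : ℝ | ψ y = M}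

lemma eq_of_mem_levelInterior {ψ : CircleFun} {M x : ℝ} (hx : x ∈ levelInterior ψ M) : ψ x = M := by
  have h : x ∈ {y : ℝ | ψ y = M} := interior_subset hx
  exact h

lemma add_int_mem_levelInterior {ψ : CircleFun} {M x : ℝ} (hx : x ∈ levelInterior ψ M) (k : ℤ) :
    x + k ∈ levelInterior ψ M := by
  have h : {y : ℝ | ψ y = M} = (Homeomorph.addRight (k : ℝ)) ⁻¹' {y : ℝ | ψ y = M} := by
    ext y
    simp
  rw [levelInterior, h, ← Homeomorph.preimage_interior] at hx
  exact hx

lemma add_mem_levelInterior {ε σ τ : ℝ} (hσ : 0 < σ) {ψ : CircleFun}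
    (hψ : noisyKoopman ε σ τ ψ = ψ) {M : ℝ} (hM : ∀ x, ψ x ≤ M) {y : ℝ} (hy : ψ y = M) {s : ℝ}
    (hs : s ∈ Ioo (-(σ / 2)) (σ / 2)) : arnoldR τ ε y + s ∈ levelInterior ψ M := by
  refine mem_interior.2 ⟨Ioo (arnoldR τ ε y - σ / 2) (arnoldR τ ε y + σ / 2), fun z hz => ?_,
    isOpen_Ioo, ⟨by linarith [hs.1], by linarith [hs.2]⟩⟩
  have := eq_max_of_noisyKoopman_eq hσ hψ hM hy (s := z - arnoldR τ ε y)
    ⟨by linarith [hz.1], by linarith [hz.2]⟩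
  rwa [add_sub_cancel] at this

/-- Continuous functions fixed by the Koopman operator are constant. -/
lemma exists_const_of_noisyKoopman_eq {ε σ τ : ℝ} (hε : 0 < ε) (hεπ : 2 * π * ε < 1) (hσ : 0 < σ)
    {ψ : CircleFun} (hψ : noisyKoopman ε σ τ ψ = ψ) : ∃ a, ∀ x, ψ x = a := by
  obtain ⟨y, hy⟩ := circleFun_exists_max ψ
  obtain ⟨z, hz⟩ := circleFun_exists_max (-ψ)
  have hψ' : noisyKoopman ε σ τ (-ψ) = -ψ := by rw [map_neg, hψ]
  have h0 : (0:ℝ) ∈ Ioo (-(σ / 2)) (σ / 2) := ⟨by linarith, by linarith⟩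
  by_cases hne : ψ y = ψ z
  · refine ⟨ψ y, fun x => le_antisymm (hy x) ?_⟩
    have := hz x
    simp only [ContinuousMap.neg_apply] at this
    linarith
  · refine (arnoldR_not_two_traps (τ := τ) hε hεπ hσ (U := levelInterior ψ (ψ y))
      (V := levelInterior (-ψ) ((-ψ) z)) isOpen_interior isOpen_interior ?_
      (fun x hx k => add_int_mem_levelInterior hx k)
      (fun x hx k => add_int_mem_levelInterior hx k)
      ⟨_, add_mem_levelInterior hσ hψ hy rfl h0⟩ ⟨_, add_mem_levelInterior hσ hψ' hz rfl h0⟩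
      (fun x hx s hs => add_mem_levelInterior hσ hψ hy (eq_of_mem_levelInterior hx) hs)
      (fun x hx s hs => add_mem_levelInterior hσ hψ' hz (eq_of_mem_levelInterior hx) hs)).elim
    rw [Set.disjoint_left]
    intro x hx hx'
    have h1 : ψ x = ψ y := eq_of_mem_levelInterior hx
    have h2 : (-ψ) x = (-ψ) z := eq_of_mem_levelInterior hx'
    simp only [ContinuousMap.neg_apply, neg_inj] at h2
    exact hne (h1.symm.trans h2)

lemma noisyKoopman_le {ε σ τ : ℝ} {ψ : CircleFun} {M : ℝ} (hM : ∀ x, ψ x ≤ M)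
    (x : AddCircle (1:ℝ)) : noisyKoopman ε σ τ ψ x ≤ M := by
  induction x using QuotientAddGroup.induction_on with
  | H y =>
  rw [noisyKoopman_coe]
  have hψc : Continuous fun w : ℝ => ψ (arnoldR τ ε y + σ * w : ℝ) :=
    (continuous_comp_coe ψ).comp (by fun_prop)
  have hi : Integrable (fun w : ℝ => ψ (arnoldR τ ε y + σ * w : ℝ)) nuI := hψc.integrableOn_Icc
  refine (integral_mono hi (integrable_const M) fun w => hM _).trans ?_
  rw [integral_const, probReal_univ, one_smul]

lemma circleMean_nonpos_of_dual {ε σ τ : ℝ} {ψ : CircleFun}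
    (h : (1 - noisyKoopman ε σ τ + circleMean) ψ = 0) : ∫ x, ψ x ≤ 0 := by
  obtain ⟨y, hy⟩ := circleFun_exists_max ψ
  have h1 : ψ y - noisyKoopman ε σ τ ψ y + ∫ x, ψ x = 0 := DFunLike.congr_fun h (y : AddCircle (1:ℝ))
  have h2 := noisyKoopman_le (ε := ε) (σ := σ) (τ := τ) hy y
  linarith

lemma eq_zero_of_dual {ε σ τ : ℝ} (hε : 0 < ε) (hεπ : 2 * π * ε < 1) (hσ : 0 < σ) {ψ : CircleFun}
    (h : (1 - noisyKoopman ε σ τ + circleMean) ψ = 0) : ψ = 0 := by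
  have h1 := circleMean_nonpos_of_dual h
  have h2 := circleMean_nonpos_of_dual (ψ := -ψ) (by rw [map_neg, h, neg_zero])
  simp only [ContinuousMap.neg_apply, integral_neg] at h2
  have h0 : ∫ x, ψ x = 0 := by linarith
  have h3 : noisyKoopman ε σ τ ψ = ψ := by
    ext x
    have : ψ x - noisyKoopman ε σ τ ψ x + ∫ x, ψ x = 0 := DFunLike.congr_fun h x
    linarith
  obtain ⟨a, ha⟩ := exists_const_of_noisyKoopman_eq hε hεπ hσ h3
  ext x
  simp only [ha] at h0 ⊢
  simpa using h0

/-- The Fredholm alternative for `1 - T`, `T` compact. -/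
lemma isUnit_one_sub_of_compact {X : Type*} [NormedAddCommGroup X] [NormedSpace ℝ X]
    [CompleteSpace X] {T : X →L[ℝ] X} (hT : IsCompactOperator T)
    (h : ∀ u, (1 - T) u = 0 → u = 0) : IsUnit (1 - T) := by
  rcases hT.hasEigenvalue_or_mem_resolventSet one_ne_zero with h1 | h1
  · obtain ⟨u, hu⟩ := h1.exists_hasEigenvector
    have h2 : T u = u := by simpa using hu.apply_eq_smul
    exact (hu.2 (h u (by simp [h2]))).elim
  · simpa [spectrum.mem_resolventSet_iff] using h1

lemma isUnit_dual {ε σ : ℝ} (hε : 0 < ε) (hεπ : 2 * π * ε < 1) (hσ : 0 < σ) (τ : ℝ) :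
    IsUnit (1 - noisyKoopman ε σ τ + circleMean) := by
  rw [sub_add]
  refine isUnit_one_sub_of_compact ?_ fun u hu => ?_
  · exact ((isCompactOperator_circleAvg τ hσ.ne').clm_comp (circleComp (arnoldCircle ε))).sub
      isCompactOperator_circleMean
  · rw [← sub_add] at hu
    exact eq_zero_of_dual hε hεπ hσ hu

lemma exists_dual_eq {ε σ : ℝ} (hε : 0 < ε) (hεπ : 2 * π * ε < 1) (hσ : 0 < σ) (τ : ℝ)
    (χ : CircleFun) : ∃ ψ, (1 - noisyKoopman ε σ τ + circleMean) ψ = χ :=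
  (ContinuousLinearMap.isUnit_iff_bijective.1 (isUnit_dual hε hεπ hσ τ)).2 χ

lemma isUnit_statOp {ε σ : ℝ} (hε : 0 < ε) (hεπ : 2 * π * ε < 1) (hσ : 0 < σ) (τ : ℝ) :
    IsUnit (statOp hε hεπ σ τ) := by
  refine isUnit_one_sub_of_compact
    ((isCompactOperator_circleAvg _ (neg_ne_zero.2 hσ.ne')).comp_clm _) fun u hu => ?_
  obtain ⟨ψ, hψ⟩ := exists_dual_eq hε hεπ hσ τ u
  have h1 := integral_statOp hε hεπ σ τ ψ u
  rw [hψ, statOp, hu] at h1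
  simp only [ContinuousMap.zero_apply, mul_zero, integral_zero] at h1
  have h2 := (integral_eq_zero_iff_of_nonneg (fun x => mul_self_nonneg (u x))
    (circleFun_integrable (u * u) _)).1 h1
  have h3 := (Continuous.ae_eq_iff_eq volume (u.continuous.mul u.continuous) continuous_zero).1 h2
  ext x
  simpa using congrFun h3 x

/-- The inverse of `statOp`. -/
def statInv {ε : ℝ} (hε : 0 < ε) (hεπ : 2 * π * ε < 1) (σ τ : ℝ) : CircleFun →L[ℝ] CircleFun :=
  Ring.inverse (statOp hε hεπ σ τ)

lemma statOp_statInv {ε σ : ℝ} (hε : 0 < ε) (hεπ : 2 * π * ε < 1) (hσ : 0 < σ) (τ : ℝ)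
    (v : CircleFun) : statOp hε hεπ σ τ (statInv hε hεπ σ τ v) = v :=
  DFunLike.congr_fun (Ring.mul_inverse_cancel _ (isUnit_statOp hε hεπ hσ τ)) v

lemma statInv_statOp {ε σ : ℝ} (hε : 0 < ε) (hεπ : 2 * π * ε < 1) (hσ : 0 < σ) (τ : ℝ)
    (v : CircleFun) : statInv hε hεπ σ τ (statOp hε hεπ σ τ v) = v :=
  DFunLike.congr_fun (Ring.inverse_mul_cancel _ (isUnit_statOp hε hεπ hσ τ)) v

lemma continuous_statOp {ε σ : ℝ} (hε : 0 < ε) (hεπ : 2 * π * ε < 1) (hσ : 0 < σ) :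
    Continuous (statOp hε hεπ σ) := by
  have h := (continuous_circleAvg (neg_ne_zero.2 hσ.ne')).comp continuous_neg
  exact continuous_const.sub (h.clm_comp continuous_const)

lemma continuous_statInv {ε σ : ℝ} (hε : 0 < ε) (hεπ : 2 * π * ε < 1) (hσ : 0 < σ) :
    Continuous (statInv hε hεπ σ) := by
  refine continuous_iff_continuousAt.2 fun τ => ?_
  obtain ⟨a, ha⟩ := isUnit_statOp hε hεπ hσ τ
  have h := NormedRing.inverse_continuousAt (R := CircleFun →L[ℝ] CircleFun) a
  rw [ha] at h
  exact ContinuousAt.comp (f := statOp hε hεπ σ) h (continuous_statOp hε hεπ hσ).continuousAt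

lemma Fmap_eq (τ ε σ w : ℝ) (x : AddCircle (1:ℝ)) :
    Fmap τ ε σ w x = arnoldCircle ε x + (↑(τ + σ * w) : AddCircle (1:ℝ)) := by
  induction x using QuotientAddGroup.induction_on with
  | H y =>
  change ((y + (τ + σ * w - ε * Real.sin (2 * π * y)) : ℝ) : AddCircle (1:ℝ)) =
    ((arnoldR 0 ε y + (τ + σ * w) : ℝ) : AddCircle (1:ℝ))
  congr 1
  simp only [arnoldR]; ring

lemma IsStationaryMeasure.integral_noisyKoopman {τ ε σ : ℝ} {m : Measure (AddCircle (1:ℝ))}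
    [IsProbabilityMeasure m] (hm : IsStationaryMeasure τ ε σ m) (ψ : CircleFun) :
    ∫ x, noisyKoopman ε σ τ ψ x ∂m = ∫ x, ψ x ∂m := by
  let G : ℝ × AddCircle (1:ℝ) → AddCircle (1:ℝ) := fun p => Fmap τ ε σ p.1 p.2
  have hG : Continuous G := by
    simp only [G, Fmap_eq]
    exact ((arnoldCircle ε).continuous.comp continuous_snd).add
      ((AddCircle.continuous_mk' 1).comp (by fun_prop))
  have hGw : ∀ w, Measurable (Fmap τ ε σ w) := fun w =>
    (hG.comp (Continuous.prodMk_right w)).measurable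
  have hs : ∀ s, MeasurableSet s → ∀ w, m.map (Fmap τ ε σ w) s = m (Prod.mk w ⁻¹' (G ⁻¹' s)) :=
    fun s h w => Measure.map_apply (hGw w) h
  have hmeas : Measurable fun w => m.map (Fmap τ ε σ w) := by
    refine Measure.measurable_of_measurable_coe _ fun s h => ?_
    simp_rw [hs s h]
    exact measurable_measure_prodMk_left (hG.measurable h)
  have key : (nuI.prod m).map G = m := by
    refine Eq.trans ?_ hm
    ext s h
    rw [Measure.map_apply hG.measurable h, Measure.prod_apply (hG.measurable h),
      Measure.bind_apply h hmeas.aemeasurable]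
    simp_rw [hs s h]
  have hc : Continuous fun p => ψ (G p) := ψ.continuous.comp hG
  have hint : Integrable (fun p => ψ (G p)) (nuI.prod m) :=
    Integrable.of_bound hc.aestronglyMeasurable ‖ψ‖
      (Eventually.of_forall fun p => ψ.norm_coe_le_norm _)
  conv_rhs => rw [← key]
  rw [integral_map hG.measurable.aemeasurable ψ.continuous.aestronglyMeasurable,
    integral_prod_symm _ hint]
  congr 1
  ext x
  change circleAvg τ σ ψ (arnoldCircle ε x) = _
  rw [circleAvg_apply]
  simp only [G, Fmap_eq]

lemma IsStationaryMeasure.integral_eq {τ ε σ : ℝ} (hε : 0 < ε) (hεπ : 2 * π * ε < 1) (hσ : 0 < σ)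
    {m : Measure (AddCircle (1:ℝ))} [IsProbabilityMeasure m] (hm : IsStationaryMeasure τ ε σ m)
    (χ : CircleFun) : ∫ x, χ x ∂m = ∫ x, χ x * statInv hε hεπ σ τ 1 x := by
  obtain ⟨ψ, rfl⟩ := exists_dual_eq hε hεπ hσ τ χ
  rw [integral_statOp hε hεπ, statOp_statInv hε hεπ hσ]
  have h : ∀ x, (1 - noisyKoopman ε σ τ + circleMean) ψ x =
      (ψ - noisyKoopman ε σ τ ψ) x + ∫ x, ψ x := fun x => rfl
  simp_rw [h]
  rw [integral_add (circleFun_integrable _ _) (integrable_const _)]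
  simp only [ContinuousMap.sub_apply]
  rw [integral_sub (circleFun_integrable _ _) (circleFun_integrable _ _),
    hm.integral_noisyKoopman]
  simp

/-- The stationary measure has density `statInv hε hεπ σ τ 1`. -/
lemma IsStationaryMeasure.eq_withDensity {τ ε σ : ℝ} (hε : 0 < ε) (hεπ : 2 * π * ε < 1)
    (hσ : 0 < σ) {m : Measure (AddCircle (1:ℝ))} [IsProbabilityMeasure m]
    (hm : IsStationaryMeasure τ ε σ m) :
    m = volume.withDensity (fun x => ENNReal.ofReal (statInv hε hεπ σ τ 1 x)) := by
  have hint := hm.integral_eq hε hεπ hσ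
  set φ := statInv hε hεπ σ τ 1
  have hpos : ∀ x, 0 ≤ φ x := by
    let χ : CircleFun := ⟨fun x => max (-φ x) 0, φ.continuous.neg.max continuous_const⟩
    have h0 : 0 ≤ ∫ x, χ x ∂m := integral_nonneg fun x => le_max_right _ _
    have h1 : ∀ x, χ x * φ x = -(χ x * χ x) := fun x => by
      simp only [χ, ContinuousMap.coe_mk]
      rcases le_total (-φ x) 0 with h | h
      · simp [max_eq_right h]
      · rw [max_eq_left h]; ring
    rw [hint] at h0
    simp_rw [h1, integral_neg] at h0
    have h2 : ∫ x, χ x * χ x = 0 :=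
      le_antisymm (by linarith) (integral_nonneg fun x => mul_self_nonneg _)
    have h3 := (integral_eq_zero_iff_of_nonneg (fun x => mul_self_nonneg (χ x))
      (circleFun_integrable (χ * χ) _)).1 h2
    have h4 := (Continuous.ae_eq_iff_eq volume (χ.continuous.mul χ.continuous) continuous_zero).1 h3
    intro x
    have h5 : χ x = 0 := by simpa using congrFun h4 x
    have h6 : -φ x ≤ χ x := le_max_left _ _
    linarith
  have hmeas : Measurable fun x => ENNReal.ofReal (φ x) := φ.continuous.measurable.ennreal_ofReal
  have hfin : IsFiniteMeasure (volume.withDensity fun x => ENNReal.ofReal (φ x)) :=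
    isFiniteMeasure_withDensity_ofReal (circleFun_integrable φ _).2
  refine ext_of_forall_integral_eq_of_IsFiniteMeasure fun f => ?_
  rw [integral_withDensity_eq_integral_toReal_smul hmeas
    (Eventually.of_forall fun x => ENNReal.ofReal_lt_top)]
  refine (hint f.toContinuousMap).trans ?_
  congr 1
  ext x
  rw [ENNReal.toReal_ofReal (hpos x), smul_eq_mul, mul_comm]
  rfl

/-- A real function of two real variables with `C^r` partial derivatives is `C^(r+1)`. -/
lemma contDiff_succ_of_partial {G g₁ g₂ : ℝ × ℝ → ℝ} {r : ℕ} (h₁ : ContDiff ℝ r g₁)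
    (h₂ : ContDiff ℝ r g₂) (d₁ : ∀ a b, HasDerivAt (fun t => G (t, b)) (g₁ (a, b)) a)
    (d₂ : ∀ a b, HasDerivAt (fun t => G (a, t)) (g₂ (a, b)) b) : ContDiff ℝ (r + 1) G := by
  let f₁ : ℝ × ℝ → ℝ →L[ℝ] ℝ := fun p => ContinuousLinearMap.toSpanSingleton ℝ (g₁ p)
  let f₂ : ℝ × ℝ → ℝ →L[ℝ] ℝ := fun p => ContinuousLinearMap.toSpanSingleton ℝ (g₂ p)
  have hd : ∀ p, HasFDerivAt G ((f₁ p).coprod (f₂ p)) p := fun p =>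
    (hasStrictFDerivAt_uncurry_coprod (u := p) (f := fun a b => G (a, b))
      (f₁ := fun a b => f₁ (a, b)) (f₂ := fun a b => f₂ (a, b))
      (Eventually.of_forall fun q => (d₁ q.1 q.2).hasFDerivAt)
      (Eventually.of_forall fun q => (d₂ q.1 q.2).hasFDerivAt)
      ((ContinuousLinearMap.toSpanSingletonCLE (𝕜 := ℝ) (E := ℝ)).continuous.comp
        h₁.continuous).continuousAt
      ((ContinuousLinearMap.toSpanSingletonCLE (𝕜 := ℝ) (E := ℝ)).continuous.comp
        h₂.continuous).continuousAt).hasFDerivAt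
  refine contDiff_succ_iff_hasFDerivAt.2
    ⟨fun p => g₁ p • ContinuousLinearMap.fst ℝ ℝ ℝ + g₂ p • ContinuousLinearMap.snd ℝ ℝ ℝ,
      (h₁.smul contDiff_const).add (h₂.smul contDiff_const), fun p => ?_⟩
  have h : g₁ p • ContinuousLinearMap.fst ℝ ℝ ℝ + g₂ p • ContinuousLinearMap.snd ℝ ℝ ℝ =
      (f₁ p).coprod (f₂ p) := by
    ext <;> simp [f₁, f₂]
  beta_reduce
  rw [h]
  exact hd p

/-- A one-parameter family of functions on the circle is jointly `C^r`. -/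
def SmoothFam (r : ℕ) (v : ℝ → CircleFun) : Prop :=
  ContDiff ℝ r fun p : ℝ × ℝ => v p.1 p.2

lemma smoothFam_zero_iff {v : ℝ → CircleFun} : SmoothFam 0 v ↔ Continuous v := by
  rw [SmoothFam, Nat.cast_zero, contDiff_zero]
  constructor
  · intro h
    have hq : IsOpenQuotientMap (Prod.map (id : ℝ → ℝ) (QuotientAddGroup.mk : ℝ → AddCircle (1:ℝ))) :=
      IsOpenQuotientMap.id.prodMap QuotientAddGroup.isOpenQuotientMap_mk
    have hc : Continuous fun p : ℝ × AddCircle (1:ℝ) => v p.1 p.2 :=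
      hq.isQuotientMap.continuous_iff.2 h
    exact (ContinuousMap.curry ⟨_, hc⟩).continuous
  · intro h
    exact (h.comp continuous_fst).eval ((AddCircle.continuous_mk' 1).comp continuous_snd)

lemma SmoothFam.of_le {r k : ℕ} {v : ℝ → CircleFun} (h : SmoothFam r v) (hk : k ≤ r) :
    SmoothFam k v := ContDiff.of_le h (by exact_mod_cast hk)

lemma SmoothFam.continuous {r : ℕ} {v : ℝ → CircleFun} (h : SmoothFam r v) : Continuous v :=
  smoothFam_zero_iff.1 (h.of_le r.zero_le)

/-- Pointwise differentiability with a continuous family of derivatives implies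
differentiability in the space of continuous functions. -/
lemma hasDerivAt_circleFun {v w : ℝ → CircleFun} (hw : Continuous w)
    (h : ∀ τ x, HasDerivAt (fun t => v t x) (w τ x) τ) (τ : ℝ) : HasDerivAt v (w τ) τ := by
  have hv : v = fun t => v 0 + ∫ a in (0:ℝ)..t, w a := by
    ext t x
    have h1 := (ContinuousMap.evalCLM ℝ x : CircleFun →L[ℝ] ℝ).intervalIntegral_comp_comm
      (hw.intervalIntegrable (μ := volume) 0 t)
    have h2 := intervalIntegral.integral_eq_sub_of_hasDerivAt (fun a _ => h a x)
      ((hw.eval_const x).intervalIntegrable 0 t)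
    simp only [ContinuousMap.evalCLM_apply] at h1
    rw [ContinuousMap.add_apply, ← h1, h2]
    ring
  rw [hv]
  exact (hw.integral_hasStrictDerivAt 0 τ).hasDerivAt.const_add _

lemma SmoothFam.exists_partial {r : ℕ} {v : ℝ → CircleFun} (h : SmoothFam (r + 1) v)
    (e : ℝ × ℝ) : ∃ w, SmoothFam r w ∧
      ∀ a b : ℝ, fderiv ℝ (fun p : ℝ × ℝ => v p.1 p.2) (a, b) e = w a b := by
  let G : ℝ × ℝ → ℝ := fun p => v p.1 p.2
  have hG : ContDiff ℝ (r + 1) G := by simpa [SmoothFam] using h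
  have hc : ContDiff ℝ r fun p => fderiv ℝ G p e :=
    (hG.fderiv_right le_rfl).clm_apply contDiff_const
  have hper : ∀ a, Periodic (fun b => fderiv ℝ G (a, b) e) 1 := fun a b => by
    have h1 : (fun p => G (p + ((0:ℝ), (1:ℝ)))) = G := by
      ext p
      simp [G]
    have h2 := fderiv_comp_add_right (𝕜 := ℝ) (f := G) (x := (a, b)) (0, 1)
    rw [h1, Prod.mk_add_mk, add_zero] at h2
    simp only [h2]
  exact ⟨fun a => circleLift _ (hper a) (hc.continuous.comp (by fun_prop)), hc, fun a b => rfl⟩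

lemma SmoothFam.exists_deriv_param {r : ℕ} {v : ℝ → CircleFun} (h : SmoothFam (r + 1) v) :
    ∃ w, SmoothFam r w ∧ ∀ τ, HasDerivAt v (w τ) τ := by
  obtain ⟨w, hw, hvw⟩ := h.exists_partial (1, 0)
  refine ⟨w, hw, hasDerivAt_circleFun hw.continuous fun τ x => ?_⟩
  induction x using QuotientAddGroup.induction_on with
  | H y =>
  have h1 := (ContDiff.differentiable h (by simp) (τ, y)).hasFDerivAt
  have h2 : HasDerivAt (fun t : ℝ => (t, y)) ((1:ℝ), (0:ℝ)) τ :=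
    (hasDerivAt_id τ).prodMk (hasDerivAt_const τ y)
  have h3 := h1.comp_hasDerivAt τ h2
  rw [hvw] at h3
  exact h3

lemma SmoothFam.exists_deriv_space {r : ℕ} {v : ℝ → CircleFun} (h : SmoothFam (r + 1) v) :
    ∃ w, SmoothFam r w ∧ ∀ τ y : ℝ, HasDerivAt (fun y : ℝ => v τ y) (w τ y) y := by
  obtain ⟨w, hw, hvw⟩ := h.exists_partial (0, 1)
  refine ⟨w, hw, fun τ y => ?_⟩
  have h1 := (ContDiff.differentiable h (by simp) (τ, y)).hasFDerivAt
  have h2 : HasDerivAt (fun t : ℝ => (τ, t)) ((0:ℝ), (1:ℝ)) y :=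
    (hasDerivAt_const y τ).prodMk (hasDerivAt_id y)
  have h3 := h1.comp_hasDerivAt y h2
  rw [hvw] at h3
  exact h3

lemma SmoothFam.succ {r : ℕ} {v w z : ℝ → CircleFun} (hw : SmoothFam r w) (hz : SmoothFam r z)
    (dw : ∀ τ, HasDerivAt v (w τ) τ)
    (dz : ∀ τ y : ℝ, HasDerivAt (fun y : ℝ => v τ y) (z τ y) y) : SmoothFam (r + 1) v := by
  have := contDiff_succ_of_partial (G := fun p => v p.1 p.2) hw hz
    (fun a b => (ContinuousMap.evalCLM ℝ (b : AddCircle (1:ℝ)) :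
      CircleFun →L[ℝ] ℝ).hasFDerivAt.comp_hasDerivAt a (dw a)) dz
  simpa [SmoothFam] using this

/-- The derivative of `circleAvg c s` with respect to `c`, a difference quotient. -/
def circleDiff (c s : ℝ) : CircleFun →L[ℝ] CircleFun :=
  s⁻¹ • (circleComp ⟨fun x => x + ((c + s / 2 : ℝ) : AddCircle (1:ℝ)), by fun_prop⟩ -
    circleComp ⟨fun x => x + ((c - s / 2 : ℝ) : AddCircle (1:ℝ)), by fun_prop⟩)

lemma circleDiff_apply (c s : ℝ) (u : CircleFun) (x : AddCircle (1:ℝ)) :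
    circleDiff c s u x = s⁻¹ * (u (x + ((c + s / 2 : ℝ) : AddCircle (1:ℝ))) -
      u (x + ((c - s / 2 : ℝ) : AddCircle (1:ℝ)))) := rfl

lemma circleDiff_circleMean (c s : ℝ) (u : CircleFun) : circleDiff c s (circleMean u) = 0 := by
  ext x
  simp [circleDiff_apply, circleMean_apply]

lemma hasDerivAt_circleAvg_add (c : ℝ) {s : ℝ} (hs : s ≠ 0) (u : CircleFun) (y : ℝ) :
    HasDerivAt (fun t => circleAvg (c + t) s u y) (circleDiff c s u y) 0 := by
  have hc := continuous_comp_coe u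
  have hF : ∀ b t₀ : ℝ, HasDerivAt (fun t => ∫ a in (0:ℝ)..(b + t), u (a : AddCircle (1:ℝ)))
      (u ((b + t₀ : ℝ) : AddCircle (1:ℝ))) t₀ := fun b t₀ =>
    ((hc.integral_hasStrictDerivAt 0 (b + t₀)).hasDerivAt).comp_const_add b t₀
  have h := ((hF (y + (c + s / 2)) 0).sub (hF (y + (c - s / 2)) 0)).const_mul s⁻¹
  simp only [add_zero] at h
  refine h.congr_of_eventuallyEq (Eventually.of_forall fun t => ?_)
  beta_reduce
  rw [circleAvg_apply_coe _ hs, Pi.sub_apply, intervalIntegral.integral_interval_sub_left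
    (hc.intervalIntegrable _ _) (hc.intervalIntegrable _ _)]
  congr 2 <;> ring

lemma hasDerivAt_circleAvg_space (c : ℝ) {s : ℝ} (hs : s ≠ 0) (u : CircleFun) (y : ℝ) :
    HasDerivAt (fun y : ℝ => circleAvg c s u y) (circleDiff c s u y) y := by
  have h := hasDerivAt_circleAvg_add c hs u y
  rw [← sub_self y] at h
  refine (h.comp_sub_const y y).congr_of_eventuallyEq (Eventually.of_forall fun t => ?_)
  beta_reduce
  rw [← circleAvg_add_coe, ← AddCircle.coe_add, add_sub_cancel]

lemma smoothFam_circleDiff {r : ℕ} {u : ℝ → CircleFun} (h : SmoothFam r u) (s : ℝ) :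
    SmoothFam r fun τ => circleDiff (-τ) s (u τ) := by
  have h1 : ∀ b : ℝ, ContDiff ℝ r fun p : ℝ × ℝ => u p.1 ((p.2 + (-p.1 + b) : ℝ)) := fun b =>
    ContDiff.comp (g := fun p : ℝ × ℝ => u p.1 p.2) (f := fun p : ℝ × ℝ => (p.1, p.2 + (-p.1 + b)))
      h (by fun_prop)
  exact contDiff_const.mul ((h1 (s / 2)).sub (h1 (-(s / 2))))

lemma hasDerivAt_circleAvg_neg {s : ℝ} (hs : s ≠ 0) (u : CircleFun) (τ : ℝ) :
    HasDerivAt (fun t => circleAvg (-t) s u) (-circleDiff (-τ) s u) τ := by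
  have h0 : SmoothFam 0 fun _ => u := smoothFam_zero_iff.2 continuous_const
  refine hasDerivAt_circleFun (w := fun τ => -circleDiff (-τ) s u)
    (smoothFam_circleDiff h0 s).continuous.neg (fun τ x => ?_) τ
  induction x using QuotientAddGroup.induction_on with
  | H y =>
  have h := hasDerivAt_circleAvg_add (-τ) hs u y
  rw [← sub_self τ] at h
  refine (h.comp_const_sub τ τ).congr_of_eventuallyEq (Eventually.of_forall fun t => ?_)
  beta_reduce
  rw [neg_add_eq_sub, sub_sub_cancel_left]

section
variable {ε σ : ℝ} (hε : 0 < ε) (hεπ : 2 * π * ε < 1)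

lemma smoothFam_arnoldTransfer {r : ℕ} {u : ℝ → CircleFun} (h : SmoothFam r u) :
    SmoothFam r fun τ => arnoldTransfer hε hεπ (u τ) := by
  have hk := arnoldHomeo_symm_contDiff hε hεπ
  have hk' : ContDiff ℝ r (deriv (arnoldHomeo hε hεπ).symm) :=
    (contDiff_infty_iff_deriv.1 hk).2.of_le (by exact_mod_cast le_top)
  have hk'' : ContDiff ℝ r (arnoldHomeo hε hεπ).symm := hk.of_le (by exact_mod_cast le_top)
  exact (hk'.comp contDiff_snd).mul (ContDiff.comp (g := fun p : ℝ × ℝ => u p.1 p.2)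
    (f := fun p : ℝ × ℝ => (p.1, (arnoldHomeo hε hεπ).symm p.2)) h
    (contDiff_fst.prodMk (hk''.comp contDiff_snd)))

lemma hasDerivAt_statInv (hσ : 0 < σ) {v : ℝ → CircleFun} {v' : CircleFun} {τ : ℝ}
    (hv : HasDerivAt v v' τ) : HasDerivAt (fun t => statInv hε hεπ σ t (v t))
      (statInv hε hεπ σ τ (v' - circleDiff (-τ) (-σ)
        (arnoldTransfer hε hεπ (statInv hε hεπ σ τ (v τ))))) τ := by
  have hσ' : -σ ≠ 0 := neg_ne_zero.2 hσ.ne'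
  set u := statInv hε hεπ σ τ (v τ) with hu
  let f : ℝ → CircleFun := fun t => v t - statOp hε hεπ σ t u
  have hf : HasDerivAt f (v' - circleDiff (-τ) (-σ) (arnoldTransfer hε hεπ u)) τ := by
    have h1 := (hasDerivAt_circleAvg_neg hσ' (arnoldTransfer hε hεπ u - circleMean u) τ).const_sub u
    rw [neg_neg, map_sub, circleDiff_circleMean, sub_zero] at h1
    exact hv.sub h1
  have hfτ : f τ = 0 := by simp [f, hu, statOp_statInv hε hεπ hσ]
  rw [hasDerivAt_iff_tendsto_slope] at hf ⊢
  have hinv : Tendsto (statInv hε hεπ σ) (nhdsWithin τ {τ}ᶜ) (nhds (statInv hε hεπ σ τ)) :=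
    ((continuous_statInv hε hεπ hσ).tendsto τ).mono_left nhdsWithin_le_nhds
  have hlim := (isBoundedBilinearMap_apply (𝕜 := ℝ) (E := CircleFun)
    (F := CircleFun)).continuous.tendsto _ |>.comp (hinv.prodMk_nhds hf)
  refine hlim.congr fun t => ?_
  change statInv hε hεπ σ t (slope f τ t) = _
  rw [slope_def_module, slope_def_module, hfτ, sub_zero, map_smul, map_sub,
    statInv_statOp hε hεπ hσ]

lemma smoothFam_statInv (hσ : 0 < σ) {r : ℕ} {v : ℝ → CircleFun} (h : SmoothFam r v) :
    SmoothFam r fun τ => statInv hε hεπ σ τ (v τ) := by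
  induction r generalizing v with
  | zero =>
    exact smoothFam_zero_iff.2 ((continuous_statInv hε hεπ hσ).clm_apply h.continuous)
  | succ r ih =>
    have hσ' : -σ ≠ 0 := neg_ne_zero.2 hσ.ne'
    set u : ℝ → CircleFun := fun τ => statInv hε hεπ σ τ (v τ) with hu
    have hur : SmoothFam r u := ih (h.of_le r.le_succ)
    have hD := smoothFam_circleDiff (smoothFam_arnoldTransfer hε hεπ hur) (-σ)
    obtain ⟨w, hw, dw⟩ := h.exists_deriv_param
    obtain ⟨z, hz, dz⟩ := h.exists_deriv_space
    refine SmoothFam.succ (ih (v := fun τ => w τ - circleDiff (-τ) (-σ)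
        (arnoldTransfer hε hεπ (u τ))) (ContDiff.sub hw hD))
      (z := fun τ => z τ + circleDiff (-τ) (-σ) (arnoldTransfer hε hεπ (u τ)))
      (ContDiff.add hz hD) (fun τ => hasDerivAt_statInv hε hεπ hσ (dw τ)) fun τ y => ?_
    have h1 : u τ = v τ + circleAvg (-τ) (-σ) (arnoldTransfer hε hεπ (u τ) -
        circleMean (u τ)) := by
      have := statOp_statInv hε hεπ hσ τ (v τ)
      exact sub_eq_iff_eq_add.1 this
    have h2 := (dz τ y).add (hasDerivAt_circleAvg_space (-τ) hσ'
      (arnoldTransfer hε hεπ (u τ) - circleMean (u τ)) y)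
    rw [map_sub (circleDiff _ _), circleDiff_circleMean, sub_zero] at h2
    have h3 : (fun y : ℝ => u τ y) = fun y : ℝ => v τ y + circleAvg (-τ) (-σ)
        (arnoldTransfer hε hεπ (u τ) - circleMean (u τ)) y :=
      funext fun y => DFunLike.congr_fun h1 (y : AddCircle (1:ℝ))
    change HasDerivAt (fun y : ℝ => u τ y) _ y
    rw [h3]
    exact h2

end

/-- **Smooth density of the stationary measure.**  For fixed `ε, σ`, if `m τ` is, for each
`τ`, the (unique) stationary probability measure of the noisy Arnol'd circle-map family,
then there is a jointly `C^∞` function `g(τ,x)`, `1`-periodic in `x`, such that `m τ` is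
absolutely continuous with respect to Haar (Lebesgue) measure on `ℝ/ℤ` with `C^∞` density
`x ↦ g(τ,x)`; in particular the density depends `C^∞`-smoothly on `τ`. -/
theorem noisy_circle_map_smooth_density (ε σ : ℝ)
    (hε : 0 < ε) (hεπ : 2 * π * ε < 1) (hσ : 0 < σ)
    (m : ℝ → Measure (AddCircle (1:ℝ)))
    (hm : ∀ τ, IsProbabilityMeasure (m τ) ∧ IsStationaryMeasure τ ε σ (m τ)) :
    ∃ g : ℝ → ℝ → ℝ, ContDiff ℝ (⊤ : ℕ∞) (Function.uncurry g) ∧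
      ∀ τ : ℝ, ∃ hp : Function.Periodic (g τ) 1,
        m τ = volume.withDensity (fun x => ENNReal.ofReal (hp.lift x)) := by
  refine ⟨fun τ y => statInv hε hεπ σ τ 1 y, contDiff_infty.2 fun r => ?_, fun τ => ?_⟩
  · have h1 : SmoothFam r fun _ => 1 := contDiff_const
    exact smoothFam_statInv hε hεπ hσ h1
  · have hp : Periodic (fun y : ℝ => statInv hε hεπ σ τ 1 y) 1 := fun y => by simp
    refine ⟨hp, ?_⟩
    have := (hm τ).1
    rw [(hm τ).2.eq_withDensity hε hεπ hσ]
    congr 1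
    ext x
    induction x using QuotientAddGroup.induction_on with
    | H y => rfl
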